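/- arXiv:1201.4972 — 2 statements merged into one kernel-verified Lean document; each statement's English description precedes it below -/
import Mathlib

section
/- The Selberg-type normalization constant Z_m := ∫_{ℝ^m} ∏_{1≤i<j≤m} |λ_i − λ_j| · ∏_{i=1}^m e^{−λ_i²/2} dλ satisfies Z_m = 2^{m/2}·m!·∏_{j=1}^m Γ(j/2). -/
open Real MeasureTheory

namespace Mehta

/-- sign function -/
noncomputable def sg (t : ℝ) : ℝ := t / |t|

lemma sg_mul_abs (t : ℝ) : |t| * sg t = t := by
  unfold sg
  by_cases h : t = 0
  · simp [h]
  · field_simp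

lemma sg_pos {t : ℝ} (h : 0 < t) : sg t = 1 := by
  unfold sg; rw [abs_of_pos h, div_self h.ne']

lemma sg_neg {t : ℝ} (h : t < 0) : sg t = -1 := by
  unfold sg; rw [abs_of_neg h, div_neg, div_self h.ne]

lemma sg_zero : sg 0 = 0 := by simp [sg]

lemma abs_sg_le (t : ℝ) : |sg t| ≤ 1 := by
  rcases lt_trichotomy t 0 with h | h | h
  · simp [sg_neg h]
  · simp [h, sg_zero]
  · simp [sg_pos h]

lemma measurable_sg : Measurable sg := by
  unfold sg; fun_prop

/-- weight -/
noncomputable def w (t : ℝ) : ℝ := Real.exp (-t ^ 2 / 2)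

lemma w_pos (t : ℝ) : 0 < w t := Real.exp_pos _

lemma continuous_w : Continuous w := by unfold w; fun_prop

lemma hasDerivAt_w (t : ℝ) : HasDerivAt w (-t * w t) t := by
  unfold w
  have h : HasDerivAt (fun t : ℝ => -t ^ 2 / 2) (-t) t := by
    have := ((hasDerivAt_pow 2 t).neg).div_const 2
    refine HasDerivAt.congr_deriv this ?_
    push_cast; ring
  refine HasDerivAt.congr_deriv h.exp ?_
  ring

lemma w_sq (t : ℝ) : w t * w t = Real.exp (-1 * t ^ 2) := by
  unfold w; rw [← Real.exp_add]; congr 1; ring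

lemma int_poly (P : Polynomial ℝ) {b : ℝ} (hb : 0 < b) :
    Integrable (fun t : ℝ => P.eval t * Real.exp (-b * t ^ 2)) := by
  simp_rw [Polynomial.eval_eq_sum_range, Finset.sum_mul]
  refine integrable_finsetSum _ fun i _ => ?_
  simp_rw [mul_assoc]
  apply Integrable.const_mul
  have := integrable_rpow_mul_exp_neg_mul_sq hb (s := i)
    (by have : (0:ℝ) ≤ i := by positivity
        linarith)
  simpa using this

lemma int_poly_w (P : Polynomial ℝ) : Integrable (fun t : ℝ => P.eval t * w t) := by
  have := int_poly P (b := 1 / 2) (by norm_num)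
  refine this.congr (Filter.Eventually.of_forall fun t => ?_)
  simp only [w]
  congr 2; ring

lemma int_poly_w_pow (P : Polynomial ℝ) (N : ℕ) :
    Integrable (fun t : ℝ => P.eval t * w t * (1 + |t|) ^ N) := by
  have := int_poly_w (P * (Polynomial.C 2 + Polynomial.X ^ 2) ^ N)
  refine this.mono ?_ ?_
  · have := continuous_w
    exact (by fun_prop : Continuous fun t : ℝ => P.eval t * w t * (1 + |t|) ^ N).aestronglyMeasurable
  · refine Filter.Eventually.of_forall fun t => ?_
    simp only [Polynomial.eval_mul, Polynomial.eval_pow, Polynomial.eval_add, Polynomial.eval_C,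
      Polynomial.eval_X, norm_mul, norm_pow, Real.norm_eq_abs]
    have h1 : abs (1 + |t|) ≤ |2 + t ^ 2| := by
      rw [abs_of_nonneg (by positivity : 0 ≤ 1 + |t|), abs_of_nonneg (by positivity : 0 ≤ 2 + t ^ 2), ← sq_abs t]
      nlinarith [sq_nonneg (|t| - 1)]
    have : abs (1 + |t|) ^ N ≤ |2 + t ^ 2| ^ N := pow_le_pow_left₀ (abs_nonneg _) h1 N
    calc |P.eval t| * |w t| * abs (1 + |t|) ^ N ≤ |P.eval t| * |w t| * |2 + t ^ 2| ^ N := by gcongr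
      _ = _ := by ring

/-- monic Hermite polynomials for exp(-x^2) -/
noncomputable def q : ℕ → Polynomial ℝ
  | 0 => 1
  | n + 1 => Polynomial.X * q n - Polynomial.C (1 / 2) * Polynomial.derivative (q n)

lemma monic_step (c : ℝ) {P : Polynomial ℝ} {n : ℕ} (hm : P.Monic) (hd : P.natDegree = n) :
    (Polynomial.X * P - Polynomial.C c * Polynomial.derivative P).Monic ∧
    (Polynomial.X * P - Polynomial.C c * Polynomial.derivative P).natDegree = n + 1 := by
  have hX : (Polynomial.X * P).Monic := Polynomial.monic_X.mul hm
  have hXd : (Polynomial.X * P).natDegree = n + 1 := by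
    rw [Polynomial.natDegree_X_mul hm.ne_zero, hd]
  have hlt : (Polynomial.C c * Polynomial.derivative P).degree < (Polynomial.X * P).degree := by
    rw [Polynomial.degree_eq_natDegree hX.ne_zero, hXd]
    refine lt_of_le_of_lt Polynomial.degree_le_natDegree ?_
    have h1 := Polynomial.natDegree_C_mul_le c (Polynomial.derivative P)
    have h2 := Polynomial.natDegree_derivative_le P
    exact_mod_cast (by omega)
  refine ⟨hX.sub_of_left hlt, ?_⟩
  rw [← hXd]
  exact Polynomial.natDegree_eq_of_degree_eq (Polynomial.degree_sub_eq_left_of_degree_lt hlt)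

lemma q_monic (n : ℕ) : (q n).Monic ∧ (q n).natDegree = n := by
  induction n with
  | zero => simp [q, Polynomial.monic_one]
  | succ n ih => exact monic_step _ ih.1 ih.2

lemma hasDerivAt_gauss (t : ℝ) :
    HasDerivAt (fun t : ℝ => Real.exp (-1 * t ^ 2)) (-2 * t * Real.exp (-1 * t ^ 2)) t := by
  have := ((hasDerivAt_pow 2 t).const_mul (-1)).exp
  refine HasDerivAt.congr_deriv this ?_
  push_cast; ring

lemma ortho (n : ℕ) (r : Polynomial ℝ) (hr : r.natDegree ≤ n) :
    ∫ t : ℝ, (q n).eval t * r.eval t * Real.exp (-1 * t ^ 2)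
      = r.coeff n * (√π * n.factorial / 2 ^ n) := by
  induction n generalizing r with
  | zero =>
    rw [Polynomial.eq_C_of_natDegree_le_zero hr]
    simp only [q, Polynomial.eval_one, Polynomial.eval_C, one_mul, integral_const_mul,
      integral_gaussian]
    simp
  | succ n ih =>
    have hder : ∀ t : ℝ, HasDerivAt (fun t => (q n).eval t * r.eval t * Real.exp (-1 * t ^ 2))
        ((Polynomial.derivative (q n)).eval t * r.eval t * Real.exp (-1 * t ^ 2)
         + (q n).eval t * (Polynomial.derivative r).eval t * Real.exp (-1 * t ^ 2)
         - 2 * (t * (q n).eval t * r.eval t * Real.exp (-1 * t ^ 2))) t := by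
      intro t
      have := (((q n).hasDerivAt t).mul (r.hasDerivAt t)).mul (hasDerivAt_gauss t)
      refine HasDerivAt.congr_deriv this ?_
      simp only [Pi.mul_apply]; ring
    have i1 : Integrable (fun t : ℝ => (Polynomial.derivative (q n)).eval t * r.eval t * Real.exp (-1 * t ^ 2)) := by
      simpa using int_poly (Polynomial.derivative (q n) * r) one_pos
    have i2 : Integrable (fun t : ℝ => (q n).eval t * (Polynomial.derivative r).eval t * Real.exp (-1 * t ^ 2)) := by
      simpa using int_poly (q n * Polynomial.derivative r) one_pos
    have i3 : Integrable (fun t : ℝ => t * (q n).eval t * r.eval t * Real.exp (-1 * t ^ 2)) := by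
      refine (int_poly ((Polynomial.X : Polynomial ℝ) * q n * r) one_pos).congr
        (Filter.Eventually.of_forall fun t => ?_)
      beta_reduce
      rw [Polynomial.eval_mul, Polynomial.eval_mul, Polynomial.eval_X]
    have i4 : Integrable (fun t : ℝ => (q n).eval t * r.eval t * Real.exp (-1 * t ^ 2)) := by
      simpa using int_poly (q n * r) one_pos
    have h0 := integral_eq_zero_of_hasDerivAt_of_integrable hder
      ((i1.add i2).sub (i3.const_mul 2)) i4
    have hs := integral_sub (i1.add i2) (i3.const_mul 2)
    simp only [Pi.add_apply] at hs
    rw [hs, integral_add i1 i2, integral_const_mul] at h0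
    rw [ih (Polynomial.derivative r)
      ((Polynomial.natDegree_derivative_le r).trans (by omega))] at h0
    have h1 : ∫ t : ℝ, (q (n+1)).eval t * r.eval t * Real.exp (-1 * t ^ 2) =
        (∫ t : ℝ, t * (q n).eval t * r.eval t * Real.exp (-1 * t ^ 2)) - 1 / 2 *
        ∫ t : ℝ, (Polynomial.derivative (q n)).eval t * r.eval t * Real.exp (-1 * t ^ 2) := by
      rw [← integral_const_mul, ← integral_sub i3 (i1.const_mul _)]
      congr 1; ext t
      simp only [q, Polynomial.eval_sub, Polynomial.eval_mul, Polynomial.eval_X, Polynomial.eval_C]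
      ring
    rw [h1, Nat.factorial_succ]
    rw [Polynomial.coeff_derivative] at h0
    push_cast
    rw [pow_succ]
    linear_combination (-1/2) * h0

/-- the polynomial with p w equal to minus the derivative of q w -/
noncomputable def p (n : ℕ) : Polynomial ℝ :=
  Polynomial.X * q n - Polynomial.C 1 * Polynomial.derivative (q n)

lemma p_monic (n : ℕ) : (p n).Monic ∧ (p n).natDegree = n + 1 :=
  monic_step _ (q_monic n).1 (q_monic n).2

lemma hasDerivAt_qw (n : ℕ) (t : ℝ) :
    HasDerivAt (fun t => -((q n).eval t * w t)) ((p n).eval t * w t) t := by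
  have := (((q n).hasDerivAt t).mul (hasDerivAt_w t)).neg
  refine HasDerivAt.congr_deriv this ?_
  simp only [p, Polynomial.eval_sub, Polynomial.eval_mul, Polynomial.eval_X, Polynomial.eval_C]; ring

lemma step2 (n : ℕ) (s : Finset ℝ) :
    ∫ t : ℝ, (p n).eval t * w t * ∏ a ∈ s, sg (t - a)
      = 2 * ∑ a ∈ s, (q n).eval a * w a * ∏ b ∈ s.erase a, sg (a - b) := by
  have ip := int_poly_w (p n)
  have iq := (int_poly_w (q n)).neg
  have hprod : ∀ s : Finset ℝ, Integrable (fun t => (p n).eval t * w t * ∏ a ∈ s, sg (t - a)) := by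
    intro s
    refine ip.mul_bdd (c := 1) ?_ (Filter.Eventually.of_forall fun t => ?_)
    · have := measurable_sg
      exact (by fun_prop : Measurable fun t => ∏ a ∈ s, sg (t - a)).aestronglyMeasurable
    · rw [Real.norm_eq_abs, Finset.abs_prod]
      exact Finset.prod_le_one (fun _ _ => abs_nonneg _) fun _ _ => abs_sg_le _
  induction s using Finset.induction_on_max with
  | empty =>
    simp only [Finset.prod_empty, mul_one, Finset.sum_empty, mul_zero]
    exact integral_eq_zero_of_hasDerivAt_of_integrable (hasDerivAt_qw n) ip iq
  | insert c s hc ih =>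
    have hcs : c ∉ s := fun h => lt_irrefl _ (hc c h)
    have hIoi : ∫ t in Set.Ioi c, (p n).eval t * w t = (q n).eval c * w c := by
      have ht := tendsto_zero_of_hasDerivAt_of_integrableOn_Ioi (a := c)
        (fun x _ => hasDerivAt_qw n x) ip.integrableOn iq.integrableOn
      rw [integral_Ioi_of_hasDerivAt_of_tendsto
        (hasDerivAt_qw n c).continuousAt.continuousWithinAt
        (fun x _ => hasDerivAt_qw n x) ip.integrableOn ht]
      ring
    have hae : (fun t => (p n).eval t * w t * ∏ a ∈ insert c s, sg (t - a)) =ᵐ[volume]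
        fun t => 2 * (Set.Ioi c).indicator (fun t => (p n).eval t * w t) t
          - (p n).eval t * w t * ∏ a ∈ s, sg (t - a) := by
      have : ∀ᵐ t : ℝ, t ≠ c := by simp [ae_iff]
      filter_upwards [this] with t ht
      rw [Finset.prod_insert hcs]
      rcases lt_or_gt_of_ne ht with h | h
      · rw [sg_neg (by linarith), Set.indicator_of_notMem (by simp [h.le])]; ring
      · rw [sg_pos (by linarith), Set.indicator_of_mem (by simpa using h),
          Finset.prod_eq_one fun a ha => sg_pos (by linarith [hc a ha])]
        ring
    rw [integral_congr_ae hae, integral_sub _ (hprod s), integral_const_mul,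
      integral_indicator measurableSet_Ioi, hIoi, ih, Finset.sum_insert hcs,
      Finset.erase_insert hcs, Finset.prod_eq_one fun a ha => sg_pos (by linarith [hc a ha])]
    · have : ∀ a ∈ s, (q n).eval a * w a * ∏ b ∈ (insert c s).erase a, sg (a - b)
          = - ((q n).eval a * w a * ∏ b ∈ s.erase a, sg (a - b)) := by
        intro a ha
        rw [Finset.erase_insert_of_ne (fun h : c = a => hcs (by rw [h]; exact ha)), Finset.prod_insert
          (fun h => hcs (Finset.mem_of_mem_erase h)), sg_neg (by linarith [hc a ha])]
        ring
      rw [Finset.sum_congr rfl this, Finset.sum_neg_distrib]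
      ring
    · exact (ip.indicator measurableSet_Ioi).const_mul 2

/-- absolute Vandermonde -/
noncomputable def D {n : ℕ} (x : Fin n → ℝ) : ℝ :=
  ∏ i : Fin n, ∏ j ∈ Finset.Ioi i, |x i - x j|

/-- product weight -/
noncomputable def W {n : ℕ} (x : Fin n → ℝ) : ℝ := ∏ i : Fin n, w (x i)

lemma D_eq {n : ℕ} (x : Fin n → ℝ) : D x = |(Matrix.vandermonde x).det| := by
  rw [Matrix.det_vandermonde, Finset.abs_prod]
  simp_rw [Finset.abs_prod]
  unfold D
  refine Finset.prod_congr rfl fun i _ => Finset.prod_congr rfl fun j _ => abs_sub_comm _ _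

lemma D_perm {n : ℕ} (x : Fin n → ℝ) (σ : Equiv.Perm (Fin n)) : D (x ∘ σ) = D x := by
  rw [D_eq, D_eq]
  have : Matrix.vandermonde (x ∘ σ) = (Matrix.vandermonde x).submatrix σ id := by
    ext i j; simp [Matrix.vandermonde_apply]
  rw [this, Matrix.det_permute, abs_mul]
  rcases Int.units_eq_one_or (Equiv.Perm.sign σ) with h | h <;> simp [h]

lemma D_zero_iff {n : ℕ} (x : Fin n → ℝ) : D x ≠ 0 ↔ Function.Injective x := by
  rw [D_eq, abs_ne_zero, Matrix.det_vandermonde_ne_zero_iff]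

lemma D_succ {n : ℕ} (x : Fin (n + 1) → ℝ) :
    D x = (∏ k : Fin n, |x 0 - x k.succ|) * D (fun k : Fin n => x k.succ) := by
  unfold D
  rw [Fin.prod_univ_succ]
  simp [Fin.prod_Ioi_zero, Fin.prod_Ioi_succ]

lemma D_split {n : ℕ} (j : Fin (n + 1)) (x : Fin (n + 1) → ℝ) :
    D x = (∏ k : Fin n, |x j - x (j.succAbove k)|) * D (fun k : Fin n => x (j.succAbove k)) := by
  rw [← D_perm x j.cycleRange.symm, D_succ]
  simp

lemma W_split {n : ℕ} (j : Fin (n + 1)) (x : Fin (n + 1) → ℝ) :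
    W x = w (x j) * W (fun k : Fin n => x (j.succAbove k)) := by
  unfold W
  rw [Fin.prod_univ_succAbove _ j]

lemma D_nonneg {n : ℕ} (x : Fin n → ℝ) : 0 ≤ D x := by rw [D_eq]; positivity

lemma W_nonneg {n : ℕ} (x : Fin n → ℝ) : 0 ≤ W x := Finset.prod_nonneg fun _ _ => (w_pos _).le

lemma continuous_D {n : ℕ} : Continuous (D : (Fin n → ℝ) → ℝ) := by unfold D; fun_prop

lemma continuous_W {n : ℕ} : Continuous (W : (Fin n → ℝ) → ℝ) := by
  have := continuous_w
  unfold W; fun_prop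

lemma prod_abs_le {n : ℕ} (u : ℝ) (z : Fin n → ℝ) :
    ∏ k, |u - z k| ≤ (1 + |u|) ^ n * ∏ k, (1 + |z k|) := by
  calc ∏ k, |u - z k| ≤ ∏ k, ((1 + |u|) * (1 + |z k|)) := by
        refine Finset.prod_le_prod (fun _ _ => abs_nonneg _) fun k _ => ?_
        have := abs_sub u (z k)
        nlinarith [abs_nonneg u, abs_nonneg (z k), mul_nonneg (abs_nonneg u) (abs_nonneg (z k))]
    _ = _ := by rw [Finset.prod_mul_distrib]; simp

lemma D_le {n : ℕ} (x : Fin n → ℝ) : D x ≤ ∏ i, (1 + |x i|) ^ n := by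
  induction n with
  | zero => simp [D]
  | succ n ih =>
    rw [D_succ, Fin.prod_univ_succ]
    calc _ ≤ ((1 + |x 0|) ^ n * ∏ k : Fin n, (1 + |x k.succ|)) * ∏ k : Fin n, (1 + |x k.succ|) ^ n := by
          gcongr
          · exact D_nonneg _
          · exact prod_abs_le _ _
          · exact ih _
      _ = (1 + |x 0|) ^ n * ∏ k : Fin n, (1 + |x k.succ|) ^ (n + 1) := by
          rw [mul_assoc, ← Finset.prod_mul_distrib]
          simp_rw [pow_succ']
      _ ≤ _ := by
          gcongr
          · simp
          · omega

lemma int_DW {n : ℕ} : Integrable (fun x : Fin n → ℝ => D x * W x * ∏ k, (1 + |x k|)) := by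
  have h : Integrable (fun x : Fin n → ℝ => ∏ k, (w (x k) * (1 + |x k|) ^ (n + 1))) := by
    refine Integrable.fintype_prod (f := fun _ t => w t * (1 + |t|) ^ (n + 1)) fun _ => ?_
    simpa using int_poly_w_pow 1 (n + 1)
  refine h.mono ?_ (Filter.Eventually.of_forall fun x => ?_)
  · have := continuous_D (n := n)
    have := continuous_W (n := n)
    exact (by fun_prop : Continuous fun x : Fin n → ℝ => D x * W x * ∏ k, (1 + |x k|)).aestronglyMeasurable
  · have h1 := D_nonneg x
    have h2 := W_nonneg x
    have h3 : 0 ≤ ∏ k, (1 + |x k|) := Finset.prod_nonneg fun _ _ => by positivity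
    rw [Real.norm_of_nonneg (by positivity), Real.norm_of_nonneg
      (Finset.prod_nonneg fun _ _ => mul_nonneg (w_pos _).le (by positivity))]
    simp_rw [Finset.prod_mul_distrib, pow_succ, Finset.prod_mul_distrib]
    calc D x * W x * ∏ k, (1 + |x k|) ≤ (∏ i, (1 + |x i|) ^ n) * W x * ∏ k, (1 + |x k|) := by
          gcongr; exact D_le x
      _ = _ := by unfold W; ring

lemma int_DW' {n : ℕ} : Integrable (fun x : Fin n → ℝ => D x * W x) := by
  refine int_DW.mono ?_ (Filter.Eventually.of_forall fun x => ?_)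
  · exact (continuous_D.mul continuous_W).aestronglyMeasurable
  · rw [norm_mul _ (∏ k, _)]
    refine le_mul_of_one_le_right (norm_nonneg _) ?_
    rw [Real.norm_eq_abs, Finset.abs_prod]
    have : ∏ k : Fin n, (1 : ℝ) ≤ ∏ k, abs (1 + |x k|) := by
      refine Finset.prod_le_prod (fun _ _ => zero_le_one) fun k _ => ?_
      rw [abs_of_nonneg (by positivity)]
      simp
    simpa using this

lemma int_split {n : ℕ} (f : ℝ × (Fin n → ℝ) → ℝ) (hf : Integrable f) (j : Fin (n + 1)) :
    Integrable (fun x : Fin (n + 1) → ℝ => f (x j, fun k => x (j.succAbove k))) ∧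
    ∫ x : Fin (n + 1) → ℝ, f (x j, fun k => x (j.succAbove k)) =
      ∫ y : Fin n → ℝ, ∫ t : ℝ, f (t, y) := by
  have mp := volume_preserving_piFinSuccAbove (fun _ : Fin (n + 1) => ℝ) j
  refine ⟨(mp.integrable_comp_emb (MeasurableEquiv.measurableEmbedding _)).2 hf, ?_⟩
  have h1 := mp.integral_comp' f
  have h2 := integral_prod_symm f hf
  exact h1.trans h2

lemma int_sum {n : ℕ} (f : ℝ × (Fin n → ℝ) → ℝ) (hf : Integrable f) :
    ∫ x : Fin (n + 1) → ℝ, ∑ j, f (x j, fun k => x (j.succAbove k)) =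
      (n + 1) * ∫ y : Fin n → ℝ, ∫ t : ℝ, f (t, y) := by
  rw [integral_finsetSum _ fun j _ => (int_split f hf j).1]
  simp_rw [fun j => (int_split f hf j).2]
  simp

lemma erase_eq {n : ℕ} (j : Fin (n + 1)) :
    Finset.univ.erase j = Finset.univ.image j.succAbove := by
  rw [Fin.image_succAbove_univ]; ext; simp

lemma prod_erase {n : ℕ} (j : Fin (n + 1)) (f : Fin (n + 1) → ℝ) :
    ∏ k ∈ Finset.univ.erase j, f k = ∏ k, f (j.succAbove k) := by
  rw [erase_eq, Finset.prod_image (fun a _ b _ h => Fin.succAbove_right_injective h)]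

lemma sg_prod {n : ℕ} (u : ℝ) (z : Fin n → ℝ) :
    (∏ k, |u - z k|) * ∏ k, sg (u - z k) = ∏ k, (u - z k) := by
  rw [← Finset.prod_mul_distrib]; simp_rw [sg_mul_abs]

lemma step1 {n : ℕ} (x : Fin (n + 2) → ℝ) :
    D x = ∑ j, (p n).eval (x j) * (∏ k, sg (x j - x (j.succAbove k))) *
      D (fun k => x (j.succAbove k)) := by
  by_cases hx : Function.Injective x
  · have h := Lagrange.leadingCoeff_eq_sum (s := Finset.univ) (v := x) hx.injOn (P := p n) (by
      rw [Polynomial.degree_eq_natDegree (p_monic n).1.ne_zero, (p_monic n).2]; simp; rfl)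
    rw [(p_monic n).1.leadingCoeff] at h
    rw [← mul_one (D x), h, Finset.mul_sum]
    refine Finset.sum_congr rfl fun j _ => ?_
    rw [prod_erase j (fun k => x j - x k), D_split j x, ← sg_prod]
    have hne : ∏ k, (x j - x (j.succAbove k)) ≠ 0 := Finset.prod_ne_zero_iff.2 fun k _ =>
      sub_ne_zero.2 fun h => Fin.succAbove_ne j k (hx h).symm
    have hA : ∏ k, |x j - x (j.succAbove k)| ≠ 0 := by
      rw [← Finset.abs_prod]; exact abs_ne_zero.2 hne
    have hS : ∏ k, sg (x j - x (j.succAbove k)) ≠ 0 := by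
      intro h0; rw [← sg_prod, h0, mul_zero] at hne; exact hne rfl
    have hS2 : (∏ k, sg (x j - x (j.succAbove k))) * ∏ k, sg (x j - x (j.succAbove k)) = 1 := by
      rw [← Finset.prod_mul_distrib]
      refine Finset.prod_eq_one fun k _ => ?_
      have := sub_ne_zero.2 fun h => Fin.succAbove_ne j k (hx h).symm
      rcases lt_or_gt_of_ne this with h | h
      · simp [sg_neg h]
      · simp [sg_pos h]
    rw [mul_div_assoc', div_eq_iff (mul_ne_zero hA hS)]
    linear_combination (-(∏ k, |x j - x (j.succAbove k)|) * (D fun k => x (j.succAbove k)) * (p n).eval (x j)) * hS2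
  · have h0 : D x = 0 := by by_contra h; exact hx ((D_zero_iff x).1 h)
    rw [h0, Finset.sum_eq_zero]
    intro j _
    rw [D_split j x] at h0
    rcases mul_eq_zero.1 h0 with h | h
    · obtain ⟨k, hk, hk'⟩ := Finset.prod_eq_zero_iff.1 h
      rw [Finset.prod_eq_zero hk (by rw [abs_eq_zero.1 hk', sg_zero])]; ring
    · rw [h]; ring

lemma step2' (n : ℕ) {m : ℕ} (y : Fin (m + 1) → ℝ) (hy : Function.Injective y) :
    ∫ t : ℝ, (p n).eval t * w t * ∏ k, sg (t - y k)
      = 2 * ∑ j, (q n).eval (y j) * w (y j) * ∏ k, sg (y j - y (j.succAbove k)) := by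
  have h := step2 n (Finset.univ.image y)
  rw [Finset.sum_image hy.injOn] at h
  simp_rw [Finset.prod_image hy.injOn (s := Finset.univ)] at h
  rw [h]
  congr 1
  refine Finset.sum_congr rfl fun j _ => ?_
  rw [← Finset.image_erase hy, Finset.prod_image hy.injOn, prod_erase j fun k => sg (y j - y k)]

lemma rec (n : ℕ) :
    ∫ x : Fin (n + 2) → ℝ, D x * W x
      = 2 * (n + 2) * (n + 1) * (√π * n.factorial / 2 ^ n) * ∫ x : Fin n → ℝ, D x * W x := by
  let f : ℝ × (Fin (n + 1) → ℝ) → ℝ := fun a =>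
    (∏ k, sg (a.1 - a.2 k)) * ((p n).eval a.1 * w a.1 * (D a.2 * W a.2))
  have hf : Integrable f := by
    refine ((int_poly_w (p n)).mul_prod int_DW').bdd_mul (c := 1) ?_
      (Filter.Eventually.of_forall fun t => ?_)
    · have := measurable_sg
      exact (by fun_prop : Measurable fun a : ℝ × (Fin (n + 1) → ℝ) =>
        ∏ k, sg (a.1 - a.2 k)).aestronglyMeasurable
    · rw [Real.norm_eq_abs, Finset.abs_prod]
      exact Finset.prod_le_one (fun _ _ => abs_nonneg _) fun _ _ => abs_sg_le _
  let h : ℝ × (Fin n → ℝ) → ℝ := fun a =>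
    (q n).eval a.1 * w a.1 * w a.1 * (∏ k, (a.1 - a.2 k)) * (D a.2 * W a.2)
  have hh : Integrable h := by
    have hq : Integrable (fun t : ℝ => (q n).eval t * w t * w t * (1 + |t|) ^ n) := by
      have := (int_poly_w_pow (q n) n).bdd_mul (f := w) (c := 1)
        continuous_w.aestronglyMeasurable (Filter.Eventually.of_forall fun t => by
          rw [Real.norm_of_nonneg (w_pos t).le]
          unfold w
          rw [Real.exp_le_one_iff]; nlinarith [sq_nonneg t])
      refine this.congr (Filter.Eventually.of_forall fun t => ?_)
      simp only; ring
    refine (hq.mul_prod (int_DW (n := n))).mono ?_ (Filter.Eventually.of_forall fun a => ?_)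
    · have := continuous_w
      have := continuous_D (n := n)
      have := continuous_W (n := n)
      exact (by fun_prop : Continuous h).aestronglyMeasurable
    · have h1 := prod_abs_le a.1 a.2
      have h3 : 0 ≤ ∏ k, (1 + |a.2 k|) := Finset.prod_nonneg fun _ _ => by positivity
      simp only [h, norm_mul, Real.norm_eq_abs]
      rw [Finset.abs_prod, abs_of_nonneg h3, abs_of_nonneg (a := (1 + |a.1|) ^ n) (by positivity)]
      calc |(q n).eval a.1| * |w a.1| * |w a.1| * (∏ k, |a.1 - a.2 k|) * (|D a.2| * |W a.2|)
          ≤ |(q n).eval a.1| * |w a.1| * |w a.1| * ((1 + |a.1|) ^ n * ∏ k, (1 + |a.2 k|))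
            * (|D a.2| * |W a.2|) := by gcongr
        _ = _ := by ring
  have e1 : ∀ x : Fin (n + 2) → ℝ, D x * W x = ∑ j, f (x j, fun k => x (j.succAbove k)) := by
    intro x
    rw [step1 x, Finset.sum_mul]
    refine Finset.sum_congr rfl fun j _ => ?_
    rw [W_split j x]
    simp only [f]; ring
  have e2 : ∀ y : Fin (n + 1) → ℝ, ∫ t, f (t, y) =
      2 * ∑ j, h (y j, fun k => y (j.succAbove k)) := by
    intro y
    have : ∫ t, f (t, y) = D y * W y * ∫ t, (p n).eval t * w t * ∏ k, sg (t - y k) := by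
      rw [← integral_const_mul]; congr 1; ext t; simp only [f]; ring
    rw [this]
    have hj : ∀ j, h (y j, fun k => y (j.succAbove k)) =
        D y * W y * ((q n).eval (y j) * w (y j) * ∏ k, sg (y j - y (j.succAbove k))) := by
      intro j
      rw [D_split j y, W_split j y]
      simp only [h]
      rw [← sg_prod]; ring
    simp_rw [hj, ← Finset.mul_sum]
    by_cases hy : D y = 0
    · simp [hy]
    · rw [step2' n y ((D_zero_iff y).1 hy)]; ring
  have e3 : ∀ z : Fin n → ℝ, ∫ u, h (u, z) = (√π * n.factorial / 2 ^ n) * (D z * W z) := by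
    intro z
    set r : Polynomial ℝ := ∏ k, (Polynomial.X - Polynomial.C (z k)) with hr
    have hrm : r.Monic := Polynomial.monic_prod_of_monic _ _ fun k _ => Polynomial.monic_X_sub_C _
    have hrd : r.natDegree = n := by
      rw [hr, Polynomial.natDegree_prod_of_monic _ _ fun k _ => Polynomial.monic_X_sub_C _]; simp
    have ho := ortho n r hrd.le
    have hc : r.coeff n = 1 := by
      have := hrm.coeff_natDegree; rwa [hrd] at this
    rw [hc, one_mul] at ho
    rw [← ho, ← integral_mul_const]
    congr 1; ext u
    simp only [h, hr, Polynomial.eval_prod, Polynomial.eval_sub, Polynomial.eval_X,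
      Polynomial.eval_C, ← w_sq]
    ring
  simp_rw [e1]
  rw [int_sum f hf]
  simp_rw [e2]
  rw [integral_const_mul, int_sum h hh]
  simp_rw [e3]
  rw [integral_const_mul]
  push_cast
  ring

lemma main (m : ℕ) : ∫ x : Fin m → ℝ, D x * W x
      = (2 : ℝ) ^ ((m : ℝ) / 2) * (Nat.factorial m) *
          ∏ j ∈ Finset.Icc 1 m, Real.Gamma ((j : ℝ) / 2) := by
  induction m using Nat.twoStepInduction with
  | zero => simp [D, W, integral_unique, Measure.real, volume_pi, Measure.pi_of_empty]
  | one =>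
    have h := (int_split (n := 0) (fun a => w a.1 * (1 : ℝ)) ((by
      simpa using int_poly_w 1 : Integrable w).mul_prod
        (integrable_const (1:ℝ))) 0).2
    have hg : ∫ t, w t = √2 * √π := by
      have := integral_gaussian (1/2)
      rw [← Real.sqrt_mul (by norm_num)]
      convert this using 3
      · unfold w; congr 1; ring
      · ring
    simp [D, W]
    simp [hg] at h
    rw [h]
    rw [inv_eq_one_div, Real.Gamma_one_half_eq, Real.sqrt_eq_rpow 2]
    simp [Measure.real, volume_pi, Measure.pi_of_empty]
  | more n ih _ =>
    rw [rec, ih, Finset.prod_Icc_succ_top (by omega), Finset.prod_Icc_succ_top (by omega)]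
    have hG := Real.Gamma_mul_Gamma_add_half (((n : ℝ) + 1) / 2)
    have a1 : ((n : ℝ) + 1) / 2 + 1 / 2 = ((n + 1 + 1 : ℕ) : ℝ) / 2 := by push_cast; ring
    have a2 : 2 * (((n : ℝ) + 1) / 2) = n + 1 := by ring
    have a3 : (1 : ℝ) - (n + 1) = -n := by ring
    rw [a1, a2, a3, Real.Gamma_nat_eq_factorial, Real.rpow_neg (by norm_num),
      Real.rpow_natCast] at hG
    have a4 : (2 : ℝ) ^ (((n + 2 : ℕ) : ℝ) / 2) = 2 ^ ((n : ℝ) / 2) * 2 := by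
      rw [← Real.rpow_add_one (by norm_num)]; congr 1; push_cast; ring
    rw [a4, Nat.factorial_succ, Nat.factorial_succ, mul_assoc (∏ j ∈ Finset.Icc 1 n, _)]
    have a5 : ((n + 1 : ℕ) : ℝ) / 2 = ((n : ℝ) + 1) / 2 := by push_cast; ring
    rw [a5, hG]
    push_cast
    rw [div_eq_mul_inv]
    ring

end Mehta

/-- the Selberg-type normalization constant
`Z_m = ∫_{ℝ^m} ∏_{i<j} |λ_i − λ_j| ∏_i e^{−λ_i²/2} dλ` equals
`2^{m/2} m! ∏_{j=1}^m Γ(j/2)`. -/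
theorem stmt7 (m : ℕ) (hm : 0 < m) :
    (∫ lam : Fin m → ℝ,
        (∏ i : Fin m, ∏ j ∈ Finset.Ioi i, |lam i - lam j|) *
          ∏ i : Fin m, Real.exp (-(lam i) ^ 2 / 2))
      = (2 : ℝ) ^ ((m : ℝ) / 2) * (Nat.factorial m) *
          ∏ j ∈ Finset.Icc 1 m, Real.Gamma ((j : ℝ) / 2) := by
  exact Mehta.main m
end

section
/- For v > 0 and any c ∈ ℝ, the expected absolute determinant E_{GOE_m^v}(|det(A − c·1_m)|) equals 2^{3/2}·(2v)^{(m+1)/2}·Γ((m+3)/2)·e^{c²/(4v)}·ρ_{m+1,v}(c). -/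
open Real MeasureTheory Finset

/-- The joint eigenvalue density `Q_{n,v}` of `GOE_n^v`:
`Q_{n,v}(λ) = ∏_{i<j} |λ_i − λ_j| ∏_i e^{−λ_i²/(4v)}`. -/
noncomputable def goeQ (n : ℕ) (v : ℝ) (lam : Fin n → ℝ) : ℝ :=
  (∏ i : Fin n, ∏ j ∈ Finset.Ioi i, |lam i - lam j|) *
    ∏ i : Fin n, Real.exp (-(lam i) ^ 2 / (4 * v))

/-- The normalization constant `Z_n(v)`. -/
noncomputable def goeZ (n : ℕ) (v : ℝ) : ℝ := ∫ lam : Fin n → ℝ, goeQ n v lam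

/-- The normalized 1-point correlation function of `GOE_{m+1}^v`:
`ρ_{m+1,v}(x) = (1/Z_{m+1}(v)) ∫_{ℝ^m} Q_{m+1,v}(x,λ_1,…,λ_m) dλ`. -/
noncomputable def goeRho (m : ℕ) (v : ℝ) (x : ℝ) : ℝ :=
  (1 / goeZ (m + 1) v) * ∫ lam : Fin m → ℝ, goeQ (m + 1) v (Fin.cons x lam)

namespace GoeAux

noncomputable def Vd {n : ℕ} (x : Fin n → ℝ) : ℝ := ∏ i : Fin n, ∏ j ∈ Finset.Ioi i, |x i - x j|

noncomputable def Ew {n : ℕ} (x : Fin n → ℝ) (j : Fin n) : ℝ := ∏ k ∈ univ.erase j, (x j - x k)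

noncomputable def Cr {m : ℕ} (a : Fin (m + 1) → ℝ) (b : Fin m → ℝ) : ℝ := ∏ j, ∏ i, |a j - b i|

def IL {m : ℕ} (a : Fin (m + 1) → ℝ) (b : Fin m → ℝ) : Prop :=
  ∀ i : Fin m, a i.castSucc < b i ∧ b i < a i.succ

lemma Vd_nonneg {n : ℕ} (x : Fin n → ℝ) : 0 ≤ Vd x :=
  prod_nonneg fun _ _ => prod_nonneg fun _ _ => abs_nonneg _

lemma Vd_pos {n : ℕ} {x : Fin n → ℝ} (hx : Function.Injective x) : 0 < Vd x := by
  refine prod_pos fun i _ => prod_pos fun j hj => abs_pos.2 (sub_ne_zero.2 fun h => ?_)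
  have := hx h
  simp at hj
  omega

lemma Ew_ne {n : ℕ} {x : Fin n → ℝ} (hx : Function.Injective x) (j : Fin n) : Ew x j ≠ 0 := by
  refine prod_ne_zero_iff.2 fun k hk => sub_ne_zero.2 fun h => ?_
  have := hx h
  simp at hk
  exact hk this.symm

lemma prod_Ew {n : ℕ} (x : Fin n → ℝ) : ∏ j, |Ew x j| = Vd x ^ 2 := by
  have h1 : ∀ j : Fin n, |Ew x j| = (∏ k ∈ Ioi j, |x j - x k|) * ∏ k ∈ Iio j, |x j - x k| := by
    intro j
    rw [Ew, abs_prod, ← prod_union]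
    · congr 1
      ext k
      simp
      exact ⟨fun h => by omega, fun h => by omega⟩
    · rw [disjoint_left]
      intro k
      simp
      omega
  simp_rw [h1]
  rw [prod_mul_distrib, sq]
  congr 1
  rw [Vd, prod_sigma', prod_sigma']
  refine prod_bij' (fun p _ => ⟨p.2, p.1⟩) (fun p _ => ⟨p.2, p.1⟩) ?_ ?_ ?_ ?_ ?_
  · simp
  · simp
  · simp
  · simp
  · intro p _
    exact abs_sub_comm _ _

lemma abs_vandermonde {n : ℕ} (x : Fin n → ℝ) : |(Matrix.vandermonde x).det| = Vd x := by
  rw [Matrix.det_vandermonde, abs_prod, Vd]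
  refine prod_congr rfl fun i _ => ?_
  rw [abs_prod]
  exact prod_congr rfl fun j _ => abs_sub_comm _ _

lemma Vd_cons {m : ℕ} (z : ℝ) (b : Fin m → ℝ) :
    Vd (Fin.cons z b : Fin (m + 1) → ℝ) = (∏ i, |z - b i|) * Vd b := by
  rw [Vd, Fin.prod_univ_succ]
  congr 1
  · rw [Fin.Ioi_zero_eq_map, prod_map]
    simp
  · refine prod_congr rfl fun i _ => ?_
    rw [Fin.Ioi_succ, prod_map]
    simp

noncomputable def qv {m : ℕ} (b : Fin m → ℝ) (x : ℝ) : Fin (m + 1) → ℝ :=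
  Fin.cons (∏ i, (x - b i)) (fun i => ∏ l ∈ univ.erase i, (x - b l))

open Polynomial in
noncomputable def qp {m : ℕ} (b : Fin m → ℝ) : Fin (m + 1) → ℝ[X] :=
  Fin.cons (∏ i, (X - C (b i))) (fun i => ∏ l ∈ univ.erase i, (X - C (b l)))

open Polynomial in
lemma det_qv_eq {m : ℕ} (b : Fin m → ℝ) (x : Fin (m + 1) → ℝ) :
    (Matrix.of fun j k => qv b (x j) k).det =
      (Matrix.vandermonde x).det *
        (Matrix.of fun l k : Fin (m + 1) => (qp b k).coeff (l : ℕ)).det := by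
  rw [← Matrix.det_mul]
  congr 1
  ext j k
  rw [Matrix.mul_apply]
  have hd : (qp b k).natDegree < m + 1 := by
    refine Fin.cases ?_ (fun i => ?_) k
    · simp [qp, natDegree_prod_of_monic _ _ fun i _ => monic_X_sub_C (b i)]
    · simp only [qp, Fin.cons_succ]
      rw [natDegree_prod_of_monic _ _ fun i _ => monic_X_sub_C (b i)]
      simp
  have he : qv b (x j) k = (qp b k).eval (x j) := by
    refine Fin.cases ?_ (fun i => ?_) k
    · simp [qp, qv, eval_prod]
    · simp [qp, qv, eval_prod]
  simp only [Matrix.of_apply, Matrix.vandermonde_apply]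
  rw [he, eval_eq_sum_range' hd, Finset.sum_range]
  exact Finset.sum_congr rfl fun l _ => mul_comm _ _

lemma abs_det_qv {m : ℕ} (a : Fin (m + 1) → ℝ) (b : Fin m → ℝ) (hb : Function.Injective b) :
    |(Matrix.of fun j k => qv b (a j) k).det| = Vd a * Vd b := by
  obtain ⟨z, hz⟩ : ∃ z : ℝ, z ∉ Set.range b := (Set.finite_range b).exists_notMem
  have hz' : ∏ i, |z - b i| ≠ 0 :=
    prod_ne_zero_iff.2 fun i _ => abs_ne_zero.2 (sub_ne_zero.2 fun h => hz ⟨i, h.symm⟩)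
  have h1 := det_qv_eq b (Fin.cons z b : Fin (m + 1) → ℝ)
  have h2 : (Matrix.of fun j k => qv b ((Fin.cons z b : Fin (m + 1) → ℝ) j) k).det
      = (∏ i, (z - b i)) * ∏ i, Ew b i := by
    rw [Matrix.det_succ_column_zero, Fin.sum_univ_succ, Finset.sum_eq_zero]
    · simp only [Matrix.of_apply, Fin.cons_zero, Fin.val_zero, pow_zero, one_mul, add_zero]
      congr 1
      have : (Matrix.of fun j k => qv b ((Fin.cons z b : Fin (m + 1) → ℝ) j) k).submatrix
          (Fin.succAbove 0) Fin.succ = Matrix.diagonal (Ew b) := by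
        ext i k
        simp only [Matrix.submatrix_apply, Matrix.of_apply, Fin.succAbove_zero, Fin.cons_succ, qv,
          Matrix.diagonal_apply]
        split_ifs with h
        · subst h; rfl
        · exact prod_eq_zero (i := i) (by simp [h]) (sub_self _)
      rw [this, Matrix.det_diagonal]
    · intro i _
      have : ∏ l, (b i - b l) = 0 := prod_eq_zero (mem_univ i) (sub_self _)
      simp [qv, this]
  rw [h2] at h1
  have h3 := congrArg abs h1
  rw [abs_mul, abs_mul, abs_vandermonde, Vd_cons, abs_prod, abs_prod, prod_Ew, mul_assoc] at h3
  have h4 := mul_left_cancel₀ hz' h3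
  rw [sq] at h4
  have h5 := mul_left_cancel₀ (Vd_pos hb).ne' h4
  rw [det_qv_eq, abs_mul, abs_vandermonde, ← h5]

lemma IL.strictMono_a {m : ℕ} {a : Fin (m + 1) → ℝ} {b : Fin m → ℝ} (h : IL a b) :
    StrictMono a := Fin.strictMono_iff_lt_succ.2 fun i => (h i).1.trans (h i).2

lemma IL.strictMono_b {m : ℕ} {a : Fin (m + 1) → ℝ} {b : Fin m → ℝ} (h : IL a b) :
    StrictMono b := by
  intro i j hij
  calc b i < a i.succ := (h i).2
    _ ≤ a j.castSucc := h.strictMono_a.monotone (by rw [Fin.le_def]; simp; omega)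
    _ < b j := (h j).1

lemma IL.ne {m : ℕ} {a : Fin (m + 1) → ℝ} {b : Fin m → ℝ} (h : IL a b) (j : Fin (m + 1))
    (i : Fin m) : a j - b i ≠ 0 := by
  rcases le_or_gt j i.castSucc with hj | hj
  · have := h.strictMono_a.monotone hj
    have := (h i).1
    intro h'; linarith
  · have := h.strictMono_a.monotone (Fin.castSucc_lt_iff_succ_le.1 hj)
    have := (h i).2
    intro h'; linarith

end GoeAux

namespace GoeAux
open Polynomial in
lemma eq_of_prod_eq {n : ℕ} {r s : Fin n → ℝ} (hr : StrictMono r) (hs : StrictMono s)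
    (h : (∏ i, (X - C (r i)) : ℝ[X]) = ∏ i, (X - C (s i))) : r = s := by
  refine (hr.range_inj hs).1 ?_
  have key : ∀ (q : Fin n → ℝ) (x : ℝ),
      x ∈ Set.range q ↔ (∏ i, (X - C (q i)) : ℝ[X]).eval x = 0 := by
    intro q x
    rw [eval_prod, prod_eq_zero_iff]
    simp [sub_eq_zero, eq_comm]
  ext x
  rw [key, key, h]

lemma Ew_succAbove {m : ℕ} (a : Fin (m + 1) → ℝ) (j : Fin (m + 1)) :
    Ew a j = ∏ i, (a j - a (j.succAbove i)) := by
  rw [Ew, Fin.univ_succAbove m j, erase_cons, prod_map]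
  simp

lemma IL.posA {m : ℕ} {a : Fin (m + 1) → ℝ} {b : Fin m → ℝ} (h : IL a b) (j : Fin (m + 1)) :
    0 < (∏ i, (a j - b i)) / Ew a j := by
  rw [Ew_succAbove, ← prod_div_distrib]
  refine prod_pos fun i _ => ?_
  rcases le_or_gt j i.castSucc with hj | hj
  · rw [Fin.succAbove_of_le_castSucc _ _ hj]
    have := h.strictMono_a.monotone hj
    have := h i
    exact div_pos_of_neg_of_neg (by linarith) (by linarith)
  · rw [Fin.succAbove_of_castSucc_lt _ _ hj]
    have := h.strictMono_a.monotone (Fin.castSucc_lt_iff_succ_le.1 hj)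
    have := h i
    exact div_pos (by linarith) (by linarith)

lemma IL.posB {m : ℕ} {a : Fin (m + 1) → ℝ} {b : Fin m → ℝ} (h : IL a b) (i : Fin m) :
    0 < -(∏ j, (b i - a j)) / Ew b i := by
  have hlast : b i < a (Fin.last m) :=
    (h i).2.trans_le (h.strictMono_a.monotone (Fin.le_last _))
  have e : -(∏ j, (b i - a j)) / Ew b i = (a (Fin.last m) - b i) * (b i - a i.castSucc) *
      ∏ k ∈ univ.erase i, ((b i - a k.castSucc) / (b i - b k)) := by
    rw [Fin.prod_univ_castSucc, prod_div_distrib, Ew,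
      ← mul_prod_erase univ (fun k : Fin m => b i - a k.castSucc) (mem_univ i)]
    ring
  rw [e]
  refine mul_pos (mul_pos (by linarith) (by linarith [(h i).1])) (prod_pos fun k hk => ?_)
  have hk : k ≠ i := by simpa using hk
  rcases lt_or_gt_of_ne hk with hk | hk
  · have := h.strictMono_b hk
    have := (h k).1
    exact div_pos (by linarith) (by linarith)
  · have := h.strictMono_b hk
    have h2 := (h i).2
    have : a i.succ ≤ a k.castSucc := h.strictMono_a.monotone (by rw [Fin.le_def]; simp; omega)
    exact div_pos_of_neg_of_neg (by linarith) (by linarith)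

lemma Ew_adj {n : ℕ} {t : Fin (n + 1) → ℝ} (ht : StrictMono t) (i : Fin n) :
    Ew t i.castSucc * Ew t i.succ < 0 := by
  have hne : i.castSucc ≠ i.succ := (Fin.castSucc_lt_succ (i := i)).ne
  have hlt : t i.castSucc < t i.succ := ht Fin.castSucc_lt_succ
  rw [Ew, Ew, ← mul_prod_erase (univ.erase i.castSucc) _ (show i.succ ∈ _ by simp [hne.symm]),
    ← mul_prod_erase (univ.erase i.succ) _ (show i.castSucc ∈ _ by simp [hne]),
    erase_right_comm]
  have e : ∀ x y p q : ℝ, (x - y) * p * ((y - x) * q) = -((x - y) ^ 2 * (p * q)) := by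
    intros; ring
  rw [e, ← prod_mul_distrib, neg_lt_zero]
  refine mul_pos (by have : t i.castSucc - t i.succ ≠ 0 := by linarith
                     positivity) (prod_pos fun k hk => ?_)
  simp at hk
  rcases lt_or_gt_of_ne hk.1 with h | h
  · have := ht h
    exact mul_pos (by linarith) (by linarith)
  · have h' : i.succ < k := lt_of_le_of_ne (Fin.castSucc_lt_iff_succ_le.1 h) (Ne.symm hk.2)
    have := ht h'
    exact mul_pos_of_neg_of_neg (by linarith) (by linarith)

lemma exists_root {f : ℝ → ℝ} (hf : Continuous f) {x y : ℝ} (hxy : x < y) (h : f x * f y < 0) :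
    ∃ z, x < z ∧ z < y ∧ f z = 0 := by
  rcases mul_neg_iff.1 h with ⟨h1, h2⟩ | ⟨h1, h2⟩
  · obtain ⟨z, hz, hz'⟩ := intermediate_value_Ioo' hxy.le hf.continuousOn ⟨h2, h1⟩
    exact ⟨z, hz.1, hz.2, hz'⟩
  · obtain ⟨z, hz, hz'⟩ := intermediate_value_Ioo hxy.le hf.continuousOn ⟨h1, h2⟩
    exact ⟨z, hz.1, hz.2, hz'⟩

open Polynomial in
lemma prod_coeff_top {n : ℕ} (r : Fin n → ℝ) : (∏ i, (X - C (r i)) : ℝ[X]).coeff n = 1 := by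
  have hm : (∏ i, (X - C (r i)) : ℝ[X]).Monic := monic_prod_of_monic _ _ fun i _ => monic_X_sub_C _
  have hd : (∏ i, (X - C (r i)) : ℝ[X]).natDegree = n := by
    rw [natDegree_prod_of_monic _ _ fun i _ => monic_X_sub_C (r i)]; simp
  have := hm.coeff_natDegree
  rwa [hd] at this

open Polynomial in
lemma prod_natDegree {n : ℕ} (r : Fin n → ℝ) : (∏ i, (X - C (r i)) : ℝ[X]).natDegree = n := by
  rw [natDegree_prod_of_monic _ _ fun i _ => monic_X_sub_C (r i)]; simp

open Polynomial in
lemma coeff_top_eq {n : ℕ} {t : Fin (n + 1) → ℝ} (ht : Function.Injective t) {P : ℝ[X]}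
    (hP : P.natDegree ≤ n) : P.coeff n = ∑ j, P.eval (t j) / Ew t j := by
  have := Lagrange.coeff_eq_sum (s := univ) (v := t) ht.injOn (P := P) (by
    rw [card_univ, Fintype.card_fin]
    exact lt_of_le_of_lt degree_le_natDegree (by exact_mod_cast Nat.lt_succ_of_le hP))
  simpa [Ew] using this

open Polynomial in
lemma exists_interlacing {n : ℕ} {t : Fin (n + 1) → ℝ} (ht : StrictMono t) {P : ℝ[X]}
    (hP : P.natDegree ≤ n) (h : ∀ j, 0 < P.eval (t j) / Ew t j) :
    ∃ r : Fin n → ℝ, IL t r ∧ P = C (P.coeff n) * ∏ i, (X - C (r i)) ∧ 0 < P.coeff n := by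
  have hroot : ∀ i : Fin n, ∃ z, t i.castSucc < z ∧ z < t i.succ ∧ P.eval z = 0 := by
    intro i
    refine exists_root P.continuous (ht Fin.castSucc_lt_succ) ?_
    have h1 := h i.castSucc
    have h2 := h i.succ
    have h3 := Ew_adj ht i
    have h4 := mul_pos h1 h2
    rw [div_mul_div_comm] at h4
    by_contra hc
    exact absurd h4 (not_lt.2 (div_nonpos_of_nonneg_of_nonpos (not_lt.1 hc) h3.le))
  choose r hr1 hr2 hr3 using hroot
  have hIL : IL t r := fun i => ⟨hr1 i, hr2 i⟩
  refine ⟨r, hIL, ?_, ?_⟩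
  · refine Polynomial.eq_of_degree_sub_lt_of_eval_index_eq (s := univ) (v := r)
      hIL.strictMono_b.injective.injOn ?_ ?_
    · rw [card_univ, Fintype.card_fin, degree_lt_iff_coeff_zero]
      intro k hk
      rw [coeff_sub, coeff_C_mul]
      rcases hk.eq_or_lt with rfl | hk
      · rw [prod_coeff_top]; ring
      · rw [coeff_eq_zero_of_natDegree_lt (lt_of_le_of_lt hP hk),
          coeff_eq_zero_of_natDegree_lt (p := ∏ i, (X - C (r i))) (by rw [prod_natDegree]; exact hk)]
        ring
    · intro i _
      rw [hr3, eval_mul, eval_prod, prod_eq_zero (mem_univ i) (by simp)]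
      simp
  · rw [coeff_top_eq ht.injective hP]
    exact sum_pos (fun j _ => h j) ⟨0, mem_univ _⟩

/-- the first change of variables -/
noncomputable def mapA {m : ℕ} (a : Fin (m + 1) → ℝ) (y : Fin (m + 1) → ℝ) : Fin (m + 1) → ℝ :=
  fun j => y 0 * (∏ i : Fin m, (a j - y i.succ)) / Ew a j

def setA {m : ℕ} (a : Fin (m + 1) → ℝ) : Set (Fin (m + 1) → ℝ) :=
  {y | 0 < y 0 ∧ IL a (Fin.tail y)}

open Polynomial in
lemma sum_mapA {m : ℕ} {a : Fin (m + 1) → ℝ} (ha : StrictMono a) (y : Fin (m + 1) → ℝ) :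
    ∑ j, mapA a y j = y 0 := by
  have := coeff_top_eq ha.injective
    (P := C (y 0) * ∏ i : Fin m, (X - C (y i.succ))) (n := m)
    ((natDegree_C_mul_le _ _).trans (prod_natDegree fun i : Fin m => y i.succ).le)
  rw [coeff_C_mul, prod_coeff_top fun i : Fin m => y i.succ, mul_one] at this
  rw [this]
  simp [mapA, eval_prod]

open Polynomial in
lemma injOn_mapA {m : ℕ} {a : Fin (m + 1) → ℝ} (ha : StrictMono a) :
    Set.InjOn (mapA a) (setA a) := by
  intro y hy y' hy' h
  have h0 : y 0 = y' 0 := by rw [← sum_mapA ha y, h, sum_mapA ha]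
  have hdeg : ∀ z : Fin (m + 1) → ℝ, (C (z 0) * ∏ i : Fin m, (X - C (z i.succ))).degree <
      ((univ : Finset (Fin (m + 1))).card : WithBot ℕ) := by
    intro z
    rw [card_univ, Fintype.card_fin]
    refine lt_of_le_of_lt degree_le_natDegree ?_
    exact_mod_cast Nat.lt_succ_of_le ((natDegree_C_mul_le _ _).trans
      (prod_natDegree fun i : Fin m => z i.succ).le)
  have hP : C (y 0) * ∏ i : Fin m, (X - C (y i.succ)) =
      C (y' 0) * ∏ i : Fin m, (X - C (y' i.succ)) := by
    refine Polynomial.eq_of_degrees_lt_of_eval_index_eq (s := univ) (v := a) ha.injective.injOn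
      (hdeg y) (hdeg y') ?_
    intro j _
    have := congrFun h j
    simp only [mapA] at this
    have := (div_left_inj' (Ew_ne ha.injective j)).1 this
    simpa [eval_prod] using this
  rw [h0] at hP
  have hP2 := mul_left_cancel₀ (by rw [Ne, C_eq_zero]; exact hy'.1.ne') hP
  have := eq_of_prod_eq hy.2.strictMono_b hy'.2.strictMono_b hP2
  rw [← Fin.cons_self_tail y, ← Fin.cons_self_tail y', h0, this]

open Polynomial in
lemma image_mapA {m : ℕ} {a : Fin (m + 1) → ℝ} (ha : StrictMono a) :
    mapA a '' setA a = {u | ∀ j, 0 < u j} := by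
  ext u
  constructor
  · rintro ⟨y, hy, rfl⟩ j
    rw [mapA, mul_div_assoc]
    exact mul_pos hy.1 (hy.2.posA j)
  · intro hu
    have hinj : Set.InjOn a ((univ : Finset (Fin (m + 1))) : Set (Fin (m + 1))) :=
      ha.injective.injOn
    set P := Lagrange.interpolate univ a (fun j => u j * Ew a j) with hPdef
    have hev : ∀ j, P.eval (a j) = u j * Ew a j := fun j =>
      Lagrange.eval_interpolate_at_node _ hinj (mem_univ j)
    have hd : P.natDegree ≤ m := by
      have := Lagrange.degree_interpolate_lt (fun j => u j * Ew a j) hinj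
      rw [card_univ, Fintype.card_fin] at this
      refine natDegree_le_iff_coeff_eq_zero.2 fun N hN => ?_
      exact coeff_eq_zero_of_degree_lt (this.trans_le (by exact_mod_cast hN))
    obtain ⟨r, hr, hPr, hpos⟩ := exists_interlacing ha hd (fun j => by
      rw [hev, mul_div_cancel_right₀ _ (Ew_ne ha.injective j)]; exact hu j)
    refine ⟨Fin.cons (P.coeff m) r, ⟨by simpa using hpos, by simpa using hr⟩, ?_⟩
    ext j
    have h1 := hev j
    rw [hPr] at h1
    simp only [eval_mul, eval_C, eval_prod, eval_sub, eval_X] at h1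
    simp only [mapA, Fin.cons_zero, Fin.cons_succ]
    rw [h1, mul_div_cancel_right₀ _ (Ew_ne ha.injective j)]

end GoeAux

namespace GoeAux

open Polynomial in
lemma coeff_aux {n : ℕ} (x : Fin n → ℝ) :
    (∀ k, k + 1 = n → (∏ i, (X - C (x i)) : ℝ[X]).coeff k = -∑ i, x i) ∧
    (∀ k, k + 2 = n → 2 * (∏ i, (X - C (x i)) : ℝ[X]).coeff k =
      (∑ i, x i) ^ 2 - ∑ i, x i ^ 2) := by
  induction n with
  | zero => exact ⟨fun k hk => by omega, fun k hk => by omega⟩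
  | succ n ih =>
    obtain ⟨h1, h2⟩ := ih (fun i => x i.succ)
    have ht := prod_coeff_top (fun i : Fin n => x i.succ)
    rw [Fin.prod_univ_succ, Fin.sum_univ_succ, Fin.sum_univ_succ]
    constructor
    · intro k hk
      obtain rfl : k = n := by omega
      rw [sub_mul, coeff_sub, coeff_C_mul, ht]
      cases k with
      | zero => simp
      | succ k =>
        rw [coeff_X_mul, h1 k rfl]; ring
    · intro k hk
      rw [sub_mul, coeff_sub, coeff_C_mul, h1 k (by omega)]
      cases k with
      | zero =>
        obtain rfl : n = 1 := by omega
        simp; ring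
      | succ k =>
        have := h2 k (by omega)
        rw [coeff_X_mul, mul_sub, this]; ring

/-- the second change of variables -/
noncomputable def mapB {m : ℕ} (b : Fin m → ℝ) (a : Fin (m + 1) → ℝ) : Fin (m + 1) → ℝ :=
  Fin.cons (∑ j, a j - ∑ i, b i) (fun i => -(∏ j, (b i - a j)) / Ew b i)

def setB {m : ℕ} (b : Fin m → ℝ) : Set (Fin (m + 1) → ℝ) := {a | IL a b}

open Polynomial in
lemma sumsq_mapB {m : ℕ} {b : Fin m → ℝ} (hb : StrictMono b) (a : Fin (m + 1) → ℝ) :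
    ∑ j, a j ^ 2 = ∑ i, b i ^ 2 + (mapB b a 0) ^ 2 + 2 * ∑ i : Fin m, mapB b a i.succ := by
  cases m with
  | zero => simp [mapB]
  | succ m =>
    set s := ∑ j, a j - ∑ i, b i with hs
    set x : Fin (m + 2) → ℝ := Fin.cons s b with hx
    have hxs : ∑ i, x i = ∑ j, a j := by
      rw [Fin.sum_univ_succ]; simp [hx, hs]
    have hxs2 : ∑ i, x i ^ 2 = s ^ 2 + ∑ j, b j ^ 2 := by
      rw [Fin.sum_univ_succ]; simp [hx]
    set R : ℝ[X] := ∏ j, (X - C (a j)) - ∏ j, (X - C (x j)) with hR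
    have hd : R.natDegree ≤ m := by
      refine natDegree_le_iff_coeff_eq_zero.2 fun N hN => ?_
      rw [hR, coeff_sub]
      rcases (show N = m + 1 ∨ N = m + 2 ∨ m + 2 < N by omega) with rfl | rfl | hN
      · rw [(coeff_aux a).1 _ rfl, (coeff_aux x).1 _ rfl, hxs]; ring
      · rw [prod_coeff_top, prod_coeff_top]; ring
      · rw [coeff_eq_zero_of_natDegree_lt (p := ∏ j, (X - C (a j))),
          coeff_eq_zero_of_natDegree_lt (p := ∏ j, (X - C (x j)))]
        · ring
        · rwa [prod_natDegree]
        · rwa [prod_natDegree]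
    have h1 := coeff_top_eq hb.injective hd
    have h2 : ∑ i, R.eval (b i) / Ew b i = -∑ i : Fin (m + 1), mapB b a i.succ := by
      rw [← sum_neg_distrib]
      refine sum_congr rfl fun i _ => ?_
      simp only [mapB, Fin.cons_succ, hR, eval_sub, eval_prod, eval_X, eval_C]
      rw [prod_eq_zero (f := fun j => b i - x j) (mem_univ i.succ) (by simp [hx])]
      ring
    rw [h2] at h1
    have h3 := (coeff_aux a).2 m rfl
    have h4 := (coeff_aux x).2 m rfl
    rw [hR, coeff_sub] at h1
    rw [hxs2, hxs] at h4
    have h5 : mapB b a 0 = s := by simp [mapB, hs]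
    rw [h5]
    linarith

open Polynomial in
lemma injOn_mapB {m : ℕ} {b : Fin m → ℝ} (hb : StrictMono b) :
    Set.InjOn (mapB b) (setB b) := by
  intro a ha a' ha' h
  have h0 : ∑ j, a j = ∑ j, a' j := by
    have := congrFun h 0
    simp only [mapB, Fin.cons_zero] at this
    linarith
  refine eq_of_prod_eq (IL.strictMono_a ha) (IL.strictMono_a ha') ?_
  refine Polynomial.eq_of_degree_sub_lt_of_eval_index_eq (s := univ) (v := b)
    hb.injective.injOn ?_ ?_
  · rw [card_univ, Fintype.card_fin, degree_lt_iff_coeff_zero]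
    intro N hN
    rw [coeff_sub]
    rcases (show N = m ∨ N = m + 1 ∨ m + 1 < N by omega) with rfl | rfl | hN
    · rw [(coeff_aux a).1 _ rfl, (coeff_aux a').1 _ rfl, h0]; ring
    · rw [prod_coeff_top, prod_coeff_top]; ring
    · rw [coeff_eq_zero_of_natDegree_lt (p := ∏ j, (X - C (a j))),
        coeff_eq_zero_of_natDegree_lt (p := ∏ j, (X - C (a' j)))]
      · ring
      · rwa [prod_natDegree]
      · rwa [prod_natDegree]
  · intro i _
    have := congrFun h i.succ
    simp only [mapB, Fin.cons_succ] at this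
    have := neg_injective ((div_left_inj' (Ew_ne hb.injective i)).1 this)
    simpa [eval_prod] using this

lemma Ew_eq_ite {n : ℕ} (x : Fin n → ℝ) (j : Fin n) :
    Ew x j = ∏ k, if k = j then 1 else x j - x k := by
  rw [← mul_prod_erase univ _ (mem_univ j), if_pos rfl, one_mul, Ew]
  refine prod_congr rfl fun k hk => ?_
  rw [if_neg (by simpa using hk)]

lemma Ew_cons_zero {n : ℕ} (z : ℝ) (x : Fin n → ℝ) :
    Ew (Fin.cons z x : Fin (n + 1) → ℝ) 0 = ∏ k, (z - x k) := by
  rw [Ew_eq_ite, Fin.prod_univ_succ]; simp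

lemma Ew_cons_succ {n : ℕ} (z : ℝ) (x : Fin n → ℝ) (j : Fin n) :
    Ew (Fin.cons z x : Fin (n + 1) → ℝ) j.succ = (x j - z) * Ew x j := by
  rw [Ew_eq_ite, Fin.prod_univ_succ, Ew_eq_ite]
  simp [(Fin.succ_ne_zero j).symm]

lemma Ew_snoc_last {n : ℕ} (z : ℝ) (x : Fin n → ℝ) :
    Ew (Fin.snoc x z : Fin (n + 1) → ℝ) (Fin.last n) = ∏ k, (z - x k) := by
  rw [Ew_eq_ite, Fin.prod_univ_castSucc]; simp [Fin.castSucc_ne_last]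

lemma Ew_snoc_castSucc {n : ℕ} (z : ℝ) (x : Fin n → ℝ) (j : Fin n) :
    Ew (Fin.snoc x z : Fin (n + 1) → ℝ) j.castSucc = (x j - z) * Ew x j := by
  rw [Ew_eq_ite, Fin.prod_univ_castSucc, Ew_eq_ite, mul_comm]
  simp [(Fin.castSucc_ne_last j).symm]

open Polynomial in
lemma image_mapB {m : ℕ} {b : Fin m → ℝ} (hb : StrictMono b) :
    mapB b '' setB b = {y | ∀ i : Fin m, 0 < y i.succ} := by
  ext y
  constructor
  · rintro ⟨a, ha, rfl⟩ i
    simpa [mapB] using IL.posB ha i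
  · intro hy
    have hy : ∀ i : Fin m, 0 < y i.succ := hy
    set s := y 0 with hs
    set w : Fin m → ℝ := fun i => y i.succ with hw
    have hw0 : ∀ i, 0 < w i := hy
    set x : Fin (m + 1) → ℝ := Fin.cons s b with hx
    have hxs : ∑ i, x i = s + ∑ j, b j := by
      rw [Fin.sum_univ_succ]; simp [hx]
    set S : ℝ[X] := ∑ i, C (w i) * ∏ k ∈ univ.erase i, (X - C (b k)) with hS
    set P : ℝ[X] := ∏ j, (X - C (x j)) - S with hP
    have hSc : ∀ N, m ≤ N → S.coeff N = 0 := by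
      intro N hN
      rw [hS, finsetSum_coeff]
      refine sum_eq_zero fun i _ => ?_
      rw [coeff_C_mul, coeff_eq_zero_of_natDegree_lt, mul_zero]
      rw [natDegree_prod_of_monic _ _ fun i _ => monic_X_sub_C (b i)]
      have := i.2
      simp
      omega
    have hd : P.natDegree ≤ m + 1 := by
      refine natDegree_le_iff_coeff_eq_zero.2 fun N hN => ?_
      rw [hP, coeff_sub, hSc N (by omega),
        coeff_eq_zero_of_natDegree_lt (p := ∏ j, (X - C (x j))), sub_zero]
      rwa [prod_natDegree]
    have hc1 : P.coeff (m + 1) = 1 := by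
      rw [hP, coeff_sub, hSc _ (by omega), prod_coeff_top, sub_zero]
    have hc0 : P.coeff m = -(s + ∑ j, b j) := by
      rw [hP, coeff_sub, hSc _ le_rfl, (coeff_aux x).1 _ rfl, sub_zero, hxs]
    have hev : ∀ z, P.eval z = (z - s) * (∏ k, (z - b k)) -
        ∑ i, w i * ∏ k ∈ univ.erase i, (z - b k) := by
      intro z
      rw [hP, hS, eval_sub, eval_prod, Fin.prod_univ_succ, eval_finsetSum]
      simp [hx, eval_prod]
    have hev1 : ∀ z, (∀ k, z - b k ≠ 0) → P.eval z =
        ((z - s) - ∑ i, w i / (z - b i)) * (∏ k, (z - b k)) := by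
      intro z hz
      rw [hev, sub_mul (z - s), sum_mul]
      congr 1
      refine sum_congr rfl fun i _ => ?_
      rw [← mul_prod_erase univ _ (mem_univ i)]
      have := hz i
      field_simp
    have hev2 : ∀ i, P.eval (b i) = - (w i * Ew b i) := by
      intro i
      rw [hev, prod_eq_zero (mem_univ i) (sub_self _), sum_eq_single i]
      · rw [Ew]; ring
      · intro k _ hk
        rw [prod_eq_zero (i := i) (by simp [hk.symm]) (sub_self _), mul_zero]
      · simp
    set K : ℝ := 1 + |s| + ∑ i, w i + ∑ i, |b i| with hK
    have hW : 0 ≤ ∑ i, w i := sum_nonneg fun i _ => (hw0 i).le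
    have hB : ∀ i, |b i| ≤ ∑ i, |b i| := fun i =>
      single_le_sum (f := fun i => |b i|) (fun i _ => abs_nonneg _) (mem_univ i)
    have hB0 : 0 ≤ ∑ i, |b i| := sum_nonneg fun i _ => abs_nonneg _
    have hs1 := abs_nonneg s
    have hs2 := le_abs_self s
    have hs3 := neg_abs_le s
    have hK1 : 1 ≤ K := by linarith
    have hbu : ∀ i, 1 ≤ K - b i := fun i => by
      have := hB i
      have := le_abs_self (b i)
      linarith
    have hbl : ∀ i, 1 ≤ b i + K := fun i => by
      have := hB i
      have := neg_abs_le (b i)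
      linarith
    set t : Fin (m + 2) → ℝ := Fin.cons (-K) (Fin.snoc b K : Fin (m + 1) → ℝ) with ht
    have htm : StrictMono t := by
      refine Fin.strictMono_iff_lt_succ.2 fun j => ?_
      refine Fin.lastCases ?_ (fun i => ?_) j
      · cases m with
        | zero =>
          simp [ht, Fin.snoc]; linarith
        | succ m =>
          have e : (Fin.last (m + 1)).castSucc = (Fin.last m).castSucc.succ := rfl
          rw [e]
          simp only [ht, Fin.cons_succ, Fin.snoc_last, Fin.snoc_castSucc]
          linarith [hbu (Fin.last m)]
      · simp only [ht, Fin.cons_succ, Fin.snoc_castSucc]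
        revert i
        cases m with
        | zero => exact fun i => i.elim0
        | succ m =>
          intro i
          refine Fin.cases ?_ (fun k => ?_) i
          · have : (Fin.castSucc (Fin.castSucc (0 : Fin (m + 1)))) = 0 := rfl
            rw [this, Fin.cons_zero]
            linarith [hbl 0]
          · have : k.succ.castSucc.castSucc = k.castSucc.castSucc.succ := rfl
            rw [this, Fin.cons_succ, Fin.snoc_castSucc]
            exact hb Fin.castSucc_lt_succ
    have hpos : ∀ j, 0 < P.eval (t j) / Ew t j := by
      intro j
      refine Fin.cases ?_ (fun j => Fin.lastCases ?_ (fun i => ?_) j) j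
      · rw [ht, Ew_cons_zero, Fin.prod_univ_castSucc]
        simp only [Fin.cons_zero, Fin.snoc_castSucc, Fin.snoc_last]
        have hz : ∀ k, -K - b k ≠ 0 := fun k => by have := hbl k; intro h; linarith
        rw [hev1 _ hz, mul_comm, mul_div_mul_left _ _ (prod_ne_zero_iff.2 fun k _ => hz k)]
        refine div_pos_of_neg_of_neg ?_ (by linarith)
        have : -∑ i, w i ≤ ∑ i, w i / (-K - b i) := by
          rw [← sum_neg_distrib]
          refine sum_le_sum fun i _ => ?_
          have e : w i / (-K - b i) = -(w i / (b i + K)) := by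
            rw [← neg_add', div_neg, add_comm]
          rw [e, neg_le_neg_iff]
          exact div_le_self (hw0 i).le (hbl i)
        linarith
      · rw [ht, Ew_cons_succ, Ew_snoc_last]
        simp only [Fin.cons_succ, Fin.snoc_last]
        have hz : ∀ k, K - b k ≠ 0 := fun k => by have := hbu k; intro h; linarith
        rw [hev1 _ hz, mul_div_mul_right _ _ (prod_ne_zero_iff.2 fun k _ => hz k)]
        refine div_pos ?_ (by linarith)
        have : ∑ i, w i / (K - b i) ≤ ∑ i, w i :=
          sum_le_sum fun i _ => div_le_self (hw0 i).le (hbu i)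
        linarith
      · rw [ht, Ew_cons_succ, Ew_snoc_castSucc]
        simp only [Fin.cons_succ, Fin.snoc_castSucc]
        rw [hev2, ← mul_assoc, ← neg_mul, mul_div_mul_right _ _ (Ew_ne hb.injective i)]
        refine div_pos_of_neg_of_neg (by linarith [hw0 i]) ?_
        exact mul_neg_of_pos_of_neg (by linarith [hbl i]) (by linarith [hbu i])
    obtain ⟨r, hr, hPr, -⟩ := exists_interlacing htm hd hpos
    rw [hc1, C_1, one_mul] at hPr
    refine ⟨r, ?_, ?_⟩
    · intro i
      constructor
      · have := (hr i.castSucc).2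
        simpa [ht] using this
      · have := (hr i.succ).1
        have e : i.succ.castSucc = i.castSucc.succ := rfl
        rw [e] at this
        simpa [ht] using this
    · have hsum : ∑ j, r j = s + ∑ j, b j := by
        have := (coeff_aux r).1 m rfl
        rw [← hPr, hc0] at this
        linarith
      ext j
      refine Fin.cases ?_ (fun i => ?_) j
      · simp only [mapB, Fin.cons_zero]
        rw [hsum]; ring
      · simp only [mapB, Fin.cons_succ]
        have := hev2 i
        rw [hPr, eval_prod] at this
        simp only [eval_sub, eval_X, eval_C] at this
        rw [this, neg_neg, mul_div_cancel_right₀ _ (Ew_ne hb.injective i)]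

end GoeAux

namespace GoeAux

noncomputable def JA {m : ℕ} (a y : Fin (m + 1) → ℝ) : Matrix (Fin (m + 1)) (Fin (m + 1)) ℝ :=
  Matrix.of fun j k => (Ew a j)⁻¹ *
    ((Fin.cons 1 (fun _ => -y 0) : Fin (m + 1) → ℝ) k * qv (Fin.tail y) (a j) k)

noncomputable def JB {m : ℕ} (b : Fin m → ℝ) (a : Fin (m + 1) → ℝ) :
    Matrix (Fin (m + 1)) (Fin (m + 1)) ℝ :=
  Matrix.of fun i j => (Fin.cons 1 (fun i => (∏ l ∈ univ.erase j, (b i - a l)) / Ew b i) :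
    Fin (m + 1) → ℝ) i

lemma abs_det_JA {m : ℕ} {a y : Fin (m + 1) → ℝ} (ha : Function.Injective a)
    (hy : Function.Injective (Fin.tail y)) (h0 : 0 < y 0) :
    |(JA a y).det| = y 0 ^ m * Vd (Fin.tail y) / Vd a := by
  have h1 := Matrix.det_mul_column (fun j => (Ew a j)⁻¹) (Matrix.of fun j k =>
    (Fin.cons 1 (fun _ => -y 0) : Fin (m + 1) → ℝ) k * qv (Fin.tail y) (a j) k)
  have h2 := Matrix.det_mul_row (Fin.cons 1 (fun _ => -y 0) : Fin (m + 1) → ℝ)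
    (Matrix.of fun j k => qv (Fin.tail y) (a j) k)
  simp only [Matrix.of_apply] at h1 h2
  rw [h2] at h1
  rw [JA, h1, abs_mul, abs_mul, abs_det_qv _ _ hy, abs_prod, abs_prod]
  have h3 : ∏ j, |(Ew a j)⁻¹| = (Vd a ^ 2)⁻¹ := by
    simp_rw [abs_inv]
    rw [prod_inv_distrib, prod_Ew]
  rw [h3, Fin.prod_univ_succ]
  simp only [Fin.cons_zero, Fin.cons_succ, abs_one, abs_neg, one_mul, prod_const, card_univ,
    Fintype.card_fin, abs_of_pos h0]
  have := (Vd_pos ha).ne'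
  field_simp

lemma abs_prod_mapB {m : ℕ} (b : Fin m → ℝ) (a : Fin (m + 1) → ℝ) :
    ∏ i : Fin m, |mapB b a i.succ| = Cr a b / Vd b ^ 2 := by
  simp only [mapB, Fin.cons_succ, abs_div, abs_neg]
  rw [prod_div_distrib, prod_Ew]
  congr 1
  rw [Cr, prod_comm]
  refine prod_congr rfl fun i _ => ?_
  rw [abs_prod]
  exact prod_congr rfl fun j _ => abs_sub_comm _ _

lemma abs_prod_mapA {m : ℕ} (a y : Fin (m + 1) → ℝ) (h0 : 0 < y 0) :
    ∏ j, |mapA a y j| = y 0 ^ (m + 1) * Cr a (Fin.tail y) / Vd a ^ 2 := by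
  simp only [mapA, abs_div, abs_mul]
  rw [prod_div_distrib, prod_Ew, prod_mul_distrib]
  congr 1
  simp [abs_of_pos h0, Cr, abs_prod, Fin.tail]

lemma Cr_pos {m : ℕ} {b : Fin m → ℝ} {a : Fin (m + 1) → ℝ} (h : IL a b) : 0 < Cr a b :=
  prod_pos fun j _ => prod_pos fun i _ => abs_pos.2 (h.ne j i)

lemma abs_det_JB {m : ℕ} {b : Fin m → ℝ} {a : Fin (m + 1) → ℝ} (h : IL a b) :
    |(JB b a).det| = Vd a / Vd b := by
  have hb := h.strictMono_b.injective
  set w : Fin (m + 1) → ℝ := Fin.cons 1 (fun i : Fin m => mapB b a i.succ) with hw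
  set l : Fin (m + 1) → ℝ := fun j => (∏ i, (a j - b i))⁻¹ with hl
  have h1 := Matrix.det_mul_column w (Matrix.of fun i j => l j * qv b (a j) i)
  have h2 := Matrix.det_mul_row l (Matrix.of fun j k => qv b (a j) k).transpose
  simp only [Matrix.of_apply, Matrix.transpose_apply] at h1 h2
  rw [h2, Matrix.det_transpose] at h1
  have e : JB b a = Matrix.of fun i j => w i * (l j * qv b (a j) i) := by
    ext i j
    have hne : ∏ i, (a j - b i) ≠ 0 := prod_ne_zero_iff.2 fun i _ => h.ne j i
    refine Fin.cases ?_ (fun i => ?_) i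
    · simp [JB, hw, hl, qv, hne]
    · simp only [JB, hw, hl, qv, Matrix.of_apply, Fin.cons_succ, mapB]
      rw [← mul_prod_erase univ (fun j => b i - a j) (mem_univ j),
        ← mul_prod_erase univ (fun i => a j - b i) (mem_univ i)]
      have h3 : a j - b i ≠ 0 := h.ne j i
      have h4 : ∏ k ∈ univ.erase i, (a j - b k) ≠ 0 := prod_ne_zero_iff.2 fun i _ => h.ne j i
      have h5 := Ew_ne hb i
      field_simp
      ring
  rw [e, h1, abs_mul, abs_mul, abs_det_qv _ _ hb, abs_prod, abs_prod]
  have h3 : ∏ i, |w i| = Cr a b / Vd b ^ 2 := by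
    rw [Fin.prod_univ_succ, ← abs_prod_mapB]
    simp [hw]
  have h4 : ∏ i, |l i| = (Cr a b)⁻¹ := by
    simp [hl, Cr, abs_prod, abs_inv]
  rw [h3, h4]
  have := (Vd_pos hb).ne'
  have := (Cr_pos h).ne'
  field_simp

lemma hasFDeriv_mapA {m : ℕ} (a y : Fin (m + 1) → ℝ) :
    HasFDerivAt (mapA a) (LinearMap.toContinuousLinearMap (Matrix.toLin' (JA a y))) y := by
  refine hasFDerivAt_pi'' fun j => ?_
  have h1 : HasFDerivAt (fun y : Fin (m + 1) → ℝ => ∏ i : Fin m, (a j - y i.succ)) _ y :=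
    HasFDerivAt.finsetProd (u := univ) (g := fun (i : Fin m) (y : Fin (m + 1) → ℝ) => a j - y i.succ)
      (fun i _ => (hasFDerivAt_apply (𝕜 := ℝ) i.succ y).const_sub (a j))
  have h2 := ((hasFDerivAt_apply (𝕜 := ℝ) (0 : Fin (m + 1)) y).mul h1).mul_const (Ew a j)⁻¹
  refine HasFDerivAt.congr_fderiv (by simpa only [mapA, div_eq_mul_inv, Pi.mul_apply] using h2) ?_
  ext h
  simp [JA, Matrix.mulVec, dotProduct, Fin.sum_univ_succ, qv, Fin.tail, mul_sum]
  rw [add_comm]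
  congr 1
  · ring
  · exact congrArg Neg.neg (sum_congr rfl fun i _ => by ring)

lemma hasFDeriv_mapB {m : ℕ} (b : Fin m → ℝ) (a : Fin (m + 1) → ℝ) :
    HasFDerivAt (mapB b) (LinearMap.toContinuousLinearMap (Matrix.toLin' (JB b a))) a := by
  refine hasFDerivAt_pi'' fun i => ?_
  refine Fin.cases ?_ (fun i => ?_) i
  · have h1 : HasFDerivAt (fun a : Fin (m + 1) → ℝ => ∑ j, a j) _ a :=
      HasFDerivAt.fun_sum (u := univ) (A := fun (j : Fin (m + 1)) (a : Fin (m + 1) → ℝ) => a j)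
        (fun j _ => hasFDerivAt_apply (𝕜 := ℝ) j a)
    have h2 := h1.sub_const (∑ i, b i)
    refine HasFDerivAt.congr_fderiv (by simpa only [mapB, Fin.cons_zero] using h2) ?_
    ext h
    simp [JB, Matrix.mulVec, dotProduct]
  · have h1 : HasFDerivAt (fun a : Fin (m + 1) → ℝ => ∏ j, (b i - a j)) _ a :=
      HasFDerivAt.finsetProd (u := univ)
        (g := fun (j : Fin (m + 1)) (a : Fin (m + 1) → ℝ) => b i - a j)
        (fun j _ => (hasFDerivAt_apply (𝕜 := ℝ) j a).const_sub (b i))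
    have h2 := h1.neg.mul_const (Ew b i)⁻¹
    refine HasFDerivAt.congr_fderiv
      (by simpa only [mapB, Fin.cons_succ, div_eq_mul_inv, Pi.neg_apply] using h2) ?_
    ext h
    simp [JB, Matrix.mulVec, dotProduct, mul_sum]
    exact sum_congr rfl fun i _ => by ring

lemma measurableSet_IL {m : ℕ} {α : Type*} [MeasurableSpace α] {f : α → Fin (m + 1) → ℝ}
    {g : α → Fin m → ℝ} (hf : Measurable f) (hg : Measurable g) :
    MeasurableSet {x | IL (f x) (g x)} := by
  simp only [IL, Set.ofPred_forall, Set.ofPred_and]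
  refine MeasurableSet.iInter fun i => ?_
  exact (measurableSet_lt (by fun_prop) (by fun_prop)).inter
    (measurableSet_lt (by fun_prop) (by fun_prop))

lemma measurable_tail {m : ℕ} : Measurable (Fin.tail : (Fin (m + 1) → ℝ) → Fin m → ℝ) := by
  unfold Fin.tail
  fun_prop

lemma cvA {m : ℕ} {a : Fin (m + 1) → ℝ} (ha : StrictMono a) (g : (Fin (m + 1) → ℝ) → ENNReal) :
    ∫⁻ u in {u : Fin (m + 1) → ℝ | ∀ j, 0 < u j}, g u =
      ∫⁻ y in setA a, ENNReal.ofReal (y 0 ^ m * Vd (Fin.tail y) / Vd a) * g (mapA a y) := by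
  have hm : MeasurableSet (setA a) :=
    (measurableSet_lt measurable_const (measurable_pi_apply 0)).inter
      (measurableSet_IL measurable_const measurable_tail)
  rw [← image_mapA ha, lintegral_image_eq_lintegral_abs_det_fderiv_mul volume hm
    (fun y _ => (hasFDeriv_mapA a y).hasFDerivWithinAt) (injOn_mapA ha) g]
  refine setLIntegral_congr_fun hm fun y hy => ?_
  simp only [LinearMap.det_toContinuousLinearMap, LinearMap.det_toLin']
  rw [abs_det_JA ha.injective hy.2.strictMono_b.injective hy.1]

lemma cvB {m : ℕ} {b : Fin m → ℝ} (hb : StrictMono b) (g : (Fin (m + 1) → ℝ) → ENNReal) :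
    ∫⁻ y in {y : Fin (m + 1) → ℝ | ∀ i : Fin m, 0 < y i.succ}, g y =
      ∫⁻ a in setB b, ENNReal.ofReal (Vd a / Vd b) * g (mapB b a) := by
  have hm : MeasurableSet (setB b) := measurableSet_IL measurable_id measurable_const
  rw [← image_mapB hb, lintegral_image_eq_lintegral_abs_det_fderiv_mul volume hm
    (fun y _ => (hasFDeriv_mapB b y).hasFDerivWithinAt) (injOn_mapB hb) g]
  refine setLIntegral_congr_fun hm fun y hy => ?_
  simp only [LinearMap.det_toContinuousLinearMap, LinearMap.det_toLin']
  rw [abs_det_JB hy]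

end GoeAux

namespace GoeAux

lemma lintegral_cons {m : ℕ} {F : (Fin (m + 1) → ℝ) → ENNReal} (hF : Measurable F) :
    ∫⁻ y, F y = ∫⁻ c : ℝ, ∫⁻ x : Fin m → ℝ, F (Fin.cons c x) := by
  have h := (volume_preserving_piFinSuccAbove (fun _ : Fin (m + 1) => ℝ) 0).symm
  rw [← h.lintegral_comp hF, Measure.volume_eq_prod, lintegral_prod]
  · refine lintegral_congr fun c => lintegral_congr fun x => congrArg F ?_
    simp [MeasurableEquiv.piFinSuccAbove, Fin.insertNthEquiv]
  · exact (hF.comp (MeasurableEquiv.measurable _)).aemeasurable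

lemma lintegral_prod_fin {n : ℕ} (f : Fin n → ℝ → ENNReal) (hf : ∀ i, Measurable (f i)) :
    ∫⁻ y : Fin n → ℝ, ∏ i, f i (y i) = ∏ i, ∫⁻ x, f i x := by
  induction n with
  | zero => simp [volume_pi]
  | succ n ih =>
    rw [lintegral_cons (by
      refine Finset.measurable_fun_prod _ fun i _ => (hf i).comp (measurable_pi_apply i))]
    simp only [Fin.prod_univ_succ, Fin.cons_zero, Fin.cons_succ]
    have hm : Measurable fun x : Fin n → ℝ => ∏ i : Fin n, f i.succ (x i) :=
      Finset.measurable_fun_prod _ fun i _ => (hf i.succ).comp (measurable_pi_apply i)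
    simp_rw [lintegral_const_mul _ hm]
    rw [lintegral_mul_const _ (hf 0), ih (fun i => f i.succ) fun i => hf i.succ]

lemma lint_gamma {p r : ℝ} (hp : 0 < p) (hr : 0 < r) :
    ∫⁻ x in Set.Ioi (0 : ℝ), ENNReal.ofReal (x ^ (p - 1) * exp (-(r * x))) =
      ENNReal.ofReal ((1 / r) ^ p * Gamma p) := by
  have h := integral_rpow_mul_exp_neg_mul_Ioi hp hr
  have hpos : 0 < (1 / r) ^ p * Gamma p := mul_pos (rpow_pos_of_pos (by positivity) _)
    (Gamma_pos_of_pos hp)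
  rw [← h, ofReal_integral_eq_lintegral_ofReal]
  · by_contra hc
    rw [integral_undef hc] at h
    exact hpos.ne h
  · refine (ae_restrict_iff' measurableSet_Ioi).2 (.of_forall fun x hx => ?_)
    have : (0 : ℝ) < x := hx
    positivity

lemma lint_gauss {b : ℝ} (hb : 0 < b) :
    ∫⁻ x : ℝ, ENNReal.ofReal (exp (-b * x ^ 2)) = ENNReal.ofReal (√(π / b)) := by
  rw [← integral_gaussian b, ofReal_integral_eq_lintegral_ofReal (integrable_exp_neg_mul_sq hb)]
  exact .of_forall fun x => (exp_pos _).le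

lemma prod_ofReal {n : ℕ} {r : ℝ} {u : Fin n → ℝ} (hu : ∀ j, 0 < u j) :
    ∏ j, ENNReal.ofReal (u j ^ ((1 : ℝ) / 2 - 1) * exp (-(r * u j))) =
      ENNReal.ofReal ((∏ j, |u j|) ^ (-(1 : ℝ) / 2) * exp (-(r * ∑ j, u j))) := by
  rw [← ENNReal.ofReal_prod_of_nonneg fun j _ => by have := hu j; positivity]
  congr 1
  rw [prod_mul_distrib, ← exp_sum, Real.finsetProd_rpow _ _ (fun j _ => (hu j).le), mul_sum,
    sum_neg_distrib]
  simp_rw [abs_of_pos (hu _)]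
  norm_num

lemma measurable_Vd {n : ℕ} : Measurable (Vd : (Fin n → ℝ) → ℝ) := by
  unfold Vd
  fun_prop

lemma measurable_Cr {m : ℕ} {α : Type*} [MeasurableSpace α] {f : α → Fin (m + 1) → ℝ}
    {g : α → Fin m → ℝ} (hf : Measurable f) (hg : Measurable g) :
    Measurable fun x => Cr (f x) (g x) := by
  unfold Cr
  fun_prop

lemma keyA {m : ℕ} {a : Fin (m + 1) → ℝ} (ha : StrictMono a) :
    ENNReal.ofReal (√π ^ (m + 1)) = ENNReal.ofReal (Gamma (((m : ℝ) + 1) / 2)) *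
      ∫⁻ b in {b : Fin m → ℝ | IL a b}, ENNReal.ofReal (Vd b * Cr a b ^ (-(1 : ℝ) / 2)) := by
  set f : ℝ → ENNReal := fun x => ENNReal.ofReal (x ^ ((1 : ℝ) / 2 - 1) * exp (-(1 * x))) with hf
  have hfm : Measurable f := by rw [hf]; fun_prop
  have hpm : MeasurableSet {u : Fin (m + 1) → ℝ | ∀ j, 0 < u j} := by
    simp only [Set.ofPred_forall]
    exact MeasurableSet.iInter fun i => measurableSet_lt (by fun_prop) (by fun_prop)
  have h := cvA ha (fun u => ∏ j, f (u j))
  have hL : ∫⁻ u in {u : Fin (m + 1) → ℝ | ∀ j, 0 < u j}, ∏ j, f (u j) =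
      ENNReal.ofReal (√π ^ (m + 1)) := by
    rw [← lintegral_indicator hpm]
    have e : ∀ u : Fin (m + 1) → ℝ,
        {u : Fin (m + 1) → ℝ | ∀ j, 0 < u j}.indicator (fun u => ∏ j, f (u j)) u =
        ∏ j, (Set.Ioi (0 : ℝ)).indicator f (u j) := by
      intro u
      by_cases hu : ∀ j, 0 < u j
      · rw [Set.indicator_of_mem (show u ∈ {u : Fin (m + 1) → ℝ | ∀ j, 0 < u j} from hu)]
        exact prod_congr rfl fun j _ => (Set.indicator_of_mem (show u j ∈ Set.Ioi 0 from hu j) f).symm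
      · rw [Set.indicator_of_notMem (show u ∉ {u : Fin (m + 1) → ℝ | ∀ j, 0 < u j} from hu)]
        push Not at hu
        obtain ⟨j, hj⟩ := hu
        exact (prod_eq_zero (mem_univ j) (Set.indicator_of_notMem (by simpa using hj) f)).symm
    simp_rw [e]
    rw [lintegral_prod_fin (fun _ => (Set.Ioi (0 : ℝ)).indicator f)
      (fun _ => hfm.indicator measurableSet_Ioi)]
    simp_rw [lintegral_indicator measurableSet_Ioi]
    rw [prod_const, card_univ, Fintype.card_fin, hf, lint_gamma (by norm_num) one_pos,
      ← ENNReal.ofReal_pow (by positivity)]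
    rw [Gamma_one_half_eq, div_one, one_rpow, one_mul]
  rw [hL] at h
  rw [h]
  have hIL : MeasurableSet {b : Fin m → ℝ | IL a b} :=
    measurableSet_IL measurable_const measurable_id
  have hm : MeasurableSet (setA a) :=
    (measurableSet_lt measurable_const (measurable_pi_apply 0)).inter
      (measurableSet_IL measurable_const measurable_tail)
  set f2 : ℝ → ENNReal := fun x =>
    ENNReal.ofReal (x ^ (((m : ℝ) + 1) / 2 - 1) * exp (-(1 * x))) with hf2
  set f3 : (Fin m → ℝ) → ENNReal := fun b =>
    ENNReal.ofReal (Vd b * Cr a b ^ (-(1 : ℝ) / 2)) with hf3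
  have hf2m : Measurable f2 := by rw [hf2]; fun_prop
  have hf3m : Measurable f3 :=
    ((measurable_Vd.mul ((measurable_Cr measurable_const measurable_id).pow_const _))).ennreal_ofReal
  have e1 : ∀ y ∈ setA a, ENNReal.ofReal (y 0 ^ m * Vd (Fin.tail y) / Vd a) *
      ∏ j, f (mapA a y j) = f2 (y 0) * f3 (Fin.tail y) := by
    intro y hy
    have hy0 : 0 < y 0 := hy.1
    have hpos : ∀ j, 0 < mapA a y j := by
      have : mapA a y ∈ mapA a '' setA a := ⟨y, hy, rfl⟩
      rw [image_mapA ha] at this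
      exact this
    have hVa := Vd_pos ha.injective
    have hVb := Vd_pos hy.2.strictMono_b.injective
    have hC := Cr_pos hy.2
    rw [hf, prod_ofReal hpos, sum_mapA ha, abs_prod_mapA _ _ hy0, hf2, hf3,
      ← ENNReal.ofReal_mul (by positivity), ← ENNReal.ofReal_mul (by positivity)]
    congr 1
    have q1 : (y 0 ^ (m + 1) * Cr a (Fin.tail y) / Vd a ^ 2) ^ (-(1 : ℝ) / 2) =
        y 0 ^ (-((m : ℝ) + 1) / 2) * Cr a (Fin.tail y) ^ (-(1 : ℝ) / 2) * Vd a := by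
      rw [div_rpow (by positivity) (by positivity), mul_rpow (by positivity) hC.le,
        ← rpow_natCast, ← rpow_mul hy0.le, ← rpow_natCast, ← rpow_mul hVa.le, div_eq_mul_inv,
        ← rpow_neg hVa.le]
      congr 1
      · congr 2; push_cast; ring
      · norm_num
    have q2 : y 0 ^ (((m : ℝ) + 1) / 2 - 1) = y 0 ^ m * y 0 ^ (-((m : ℝ) + 1) / 2) := by
      rw [← rpow_natCast, ← rpow_add hy0]
      congr 1; ring
    rw [q1, q2]
    field_simp
  rw [setLIntegral_congr_fun hm e1, ← lintegral_indicator hm, lintegral_cons (by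
    exact ((hf2m.comp (measurable_pi_apply 0)).mul (hf3m.comp measurable_tail)).indicator hm)]
  have e2 : ∀ (c : ℝ) (x : Fin m → ℝ), (setA a).indicator
      (fun y => f2 (y 0) * f3 (Fin.tail y)) (Fin.cons c x : Fin (m + 1) → ℝ) =
      (Set.Ioi (0 : ℝ)).indicator f2 c * {b : Fin m → ℝ | IL a b}.indicator f3 x := by
    intro c x
    classical
    simp only [Set.indicator_apply, setA, Set.mem_ofPred_eq, Fin.cons_zero, Fin.tail_cons,
      Set.mem_Ioi]
    by_cases h1 : 0 < c <;> by_cases h2 : IL a x <;> simp [h1, h2]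
  simp_rw [e2]
  simp_rw [lintegral_const_mul _ (hf3m.indicator hIL)]
  rw [lintegral_mul_const _ (hf2m.indicator measurableSet_Ioi), lintegral_indicator hIL,
    lintegral_indicator measurableSet_Ioi, hf2, lint_gamma (by positivity) one_pos]
  simp

lemma keyB {m : ℕ} {b : Fin m → ℝ} (hb : StrictMono b) {v : ℝ} (hv : 0 < v) :
    ENNReal.ofReal (√(4 * π * v) * √(2 * π * v) ^ m * exp (-(∑ i, b i ^ 2) / (4 * v))) =
      ∫⁻ a in {a : Fin (m + 1) → ℝ | IL a b},
        ENNReal.ofReal (Vd a * Cr a b ^ (-(1 : ℝ) / 2) * exp (-(∑ j, a j ^ 2) / (4 * v))) := by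
  set f : ℝ → ENNReal := fun x =>
    ENNReal.ofReal (x ^ ((1 : ℝ) / 2 - 1) * exp (-(1 / (2 * v) * x))) with hf
  set f0 : ℝ → ENNReal := fun x => ENNReal.ofReal (exp (-(1 / (4 * v)) * x ^ 2)) with hf0
  have hfm : Measurable f := by rw [hf]; fun_prop
  have hf0m : Measurable f0 := by rw [hf0]; fun_prop
  set S : Set (Fin (m + 1) → ℝ) := {y | ∀ i : Fin m, 0 < y i.succ} with hS
  have hpm : MeasurableSet S := by
    simp only [hS, Set.ofPred_forall]
    exact MeasurableSet.iInter fun i => measurableSet_lt (by fun_prop) (by fun_prop)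
  have h := cvB hb (fun y => f0 (y 0) * ∏ j : Fin m, f (y j.succ))
  have hL : ∫⁻ y in S, f0 (y 0) * ∏ j : Fin m, f (y j.succ) =
      ENNReal.ofReal (√(4 * π * v) * √(2 * π * v) ^ m) := by
    rw [← lintegral_indicator hpm]
    set ff : Fin (m + 1) → ℝ → ENNReal :=
      Fin.cons f0 (fun _ => (Set.Ioi (0 : ℝ)).indicator f) with hff
    have e : ∀ u : Fin (m + 1) → ℝ,
        S.indicator (fun y => f0 (y 0) * ∏ j : Fin m, f (y j.succ)) u =
        ∏ j, ff j (u j) := by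
      intro u
      rw [Fin.prod_univ_succ]
      simp only [hff, Fin.cons_zero, Fin.cons_succ]
      by_cases hu : u ∈ S
      · rw [Set.indicator_of_mem hu]
        congr 1
        exact prod_congr rfl fun j _ =>
          (Set.indicator_of_mem (show u j.succ ∈ Set.Ioi 0 from hu j) f).symm
      · rw [Set.indicator_of_notMem hu]
        have hu : ¬ ∀ i : Fin m, 0 < u i.succ := hu
        push Not at hu
        obtain ⟨j, hj⟩ := hu
        rw [prod_eq_zero (mem_univ j) (Set.indicator_of_notMem (by simpa using hj) f), mul_zero]
    simp_rw [e]
    rw [lintegral_prod_fin ff (fun j => by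
      refine Fin.cases ?_ (fun j => ?_) j
      · simpa [hff] using hf0m
      · simpa [hff] using hfm.indicator measurableSet_Ioi)]
    rw [Fin.prod_univ_succ]
    simp only [hff, Fin.cons_zero, Fin.cons_succ]
    simp_rw [lintegral_indicator measurableSet_Ioi]
    rw [prod_const, card_univ, Fintype.card_fin, hf, lint_gamma (by norm_num) (by positivity),
      hf0, lint_gauss (by positivity),
      ← ENNReal.ofReal_pow (mul_nonneg (by positivity) (Gamma_pos_of_pos (by norm_num)).le),
      ← ENNReal.ofReal_mul (by positivity)]
    congr 2
    · congr 1; field_simp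
    · rw [Gamma_one_half_eq, ← sqrt_eq_rpow, ← sqrt_mul (by positivity)]
      congr 2; field_simp
  rw [hL] at h
  rw [ENNReal.ofReal_mul (by positivity), h]
  have hIL : MeasurableSet (setB b) :=
    measurableSet_IL measurable_id measurable_const
  rw [← lintegral_mul_const' _ _ ENNReal.ofReal_ne_top]
  change _ = ∫⁻ a in setB b, _
  refine setLIntegral_congr_fun hIL fun a ha => ?_
  have hpos : ∀ j : Fin m, 0 < mapB b a j.succ := by
    have : mapB b a ∈ mapB b '' setB b := ⟨a, ha, rfl⟩
    rw [image_mapB hb] at this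
    exact this
  have hVa := Vd_pos (IL.strictMono_a ha).injective
  have hVb := Vd_pos hb.injective
  have hC := Cr_pos ha
  simp only [hf, hf0]
  rw [prod_ofReal hpos, abs_prod_mapB, ← ENNReal.ofReal_mul (by positivity),
    ← ENNReal.ofReal_mul (by positivity), ← ENNReal.ofReal_mul (by positivity)]
  congr 1
  have q1 : (Cr a b / Vd b ^ 2) ^ (-(1 : ℝ) / 2) = Cr a b ^ (-(1 : ℝ) / 2) * Vd b := by
    rw [div_rpow (by positivity) (by positivity), ← rpow_natCast, ← rpow_mul hVb.le,
      div_eq_mul_inv, ← rpow_neg hVb.le]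
    norm_num
  have q2 : exp (-(∑ j, a j ^ 2) / (4 * v)) = exp (-(1 / (4 * v)) * mapB b a 0 ^ 2) *
      exp (-(1 / (2 * v) * ∑ j : Fin m, mapB b a j.succ)) * exp (-(∑ i, b i ^ 2) / (4 * v)) := by
    rw [← exp_add, ← exp_add, sumsq_mapB hb a]
    congr 1
    field_simp
    ring
  rw [q1, q2]
  field_simp

end GoeAux

namespace GoeAux

lemma goeQ_eq (n : ℕ) (v : ℝ) (x : Fin n → ℝ) :
    goeQ n v x = Vd x * exp (-(∑ i, x i ^ 2) / (4 * v)) := by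
  rw [goeQ, Vd, ← exp_sum, ← sum_div, sum_neg_distrib]

lemma goeQ_nonneg (n : ℕ) (v : ℝ) (x : Fin n → ℝ) : 0 ≤ goeQ n v x := by
  rw [goeQ_eq]
  exact mul_nonneg (Vd_nonneg x) (exp_pos _).le

lemma measurable_goeQ (n : ℕ) (v : ℝ) : Measurable (goeQ n v) := by
  unfold goeQ
  fun_prop

lemma Vd_comp {n : ℕ} (x : Fin n → ℝ) (σ : Equiv.Perm (Fin n)) : Vd (x ∘ σ) = Vd x := by
  rw [← abs_vandermonde, ← abs_vandermonde]
  have : Matrix.vandermonde (x ∘ σ) = (Matrix.vandermonde x).submatrix σ id := rfl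
  rw [this, Matrix.det_permute, abs_mul]
  have h : |((Equiv.Perm.sign σ : ℤ) : ℝ)| = 1 := by
    rcases Int.units_eq_one_or (Equiv.Perm.sign σ) with h | h <;> simp [h]
  rw [h, one_mul]

lemma goeQ_comp {n : ℕ} (v : ℝ) (x : Fin n → ℝ) (σ : Equiv.Perm (Fin n)) :
    goeQ n v (x ∘ σ) = goeQ n v x := by
  rw [goeQ_eq, goeQ_eq, Vd_comp]
  congr 4
  exact Equiv.sum_comp σ fun i => x i ^ 2

lemma goeQ_of_not_injective {n : ℕ} (v : ℝ) {x : Fin n → ℝ} (hx : ¬ Function.Injective x) :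
    goeQ n v x = 0 := by
  have : Vd x = 0 := by
    rw [← abs_vandermonde, abs_eq_zero]
    by_contra h
    exact hx (Matrix.det_vandermonde_ne_zero_iff.1 h)
  rw [goeQ_eq, this, zero_mul]

noncomputable def ZL (n : ℕ) (v : ℝ) : ENNReal := ∫⁻ x : Fin n → ℝ, ENNReal.ofReal (goeQ n v x)

noncomputable def ZO (n : ℕ) (v : ℝ) : ENNReal :=
  ∫⁻ x in {x : Fin n → ℝ | StrictMono x}, ENNReal.ofReal (goeQ n v x)

lemma measurableSet_SM {n : ℕ} : MeasurableSet {x : Fin n → ℝ | StrictMono x} := by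
  have : {x : Fin n → ℝ | StrictMono x} = {x | ∀ i j, i < j → x i < x j} := by
    ext x
    exact ⟨fun h i j hij => h hij, fun h i j hij => h i j hij⟩
  rw [this]
  simp only [Set.ofPred_forall]
  refine MeasurableSet.iInter fun i => MeasurableSet.iInter fun j => MeasurableSet.iInter fun _ => ?_
  exact measurableSet_lt (by fun_prop) (by fun_prop)

lemma goeQ_sum {n : ℕ} (v : ℝ) (x : Fin n → ℝ) :
    ENNReal.ofReal (goeQ n v x) = ∑ σ : Equiv.Perm (Fin n),
      {x : Fin n → ℝ | StrictMono x}.indicator (fun x => ENNReal.ofReal (goeQ n v x)) (x ∘ σ) := by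
  by_cases hx : Function.Injective x
  · have hs : StrictMono (x ∘ Tuple.sort x) :=
      (Tuple.monotone_sort x).strictMono_of_injective (hx.comp (Tuple.sort x).injective)
    rw [sum_eq_single (Tuple.sort x)]
    · rw [Set.indicator_of_mem (show x ∘ Tuple.sort x ∈ {x : Fin n → ℝ | StrictMono x} from hs),
        goeQ_comp]
    · intro σ _ hσ
      refine Set.indicator_of_notMem (fun h => hσ ?_) _
      have h : StrictMono (x ∘ σ) := h
      have := Tuple.unique_monotone h.monotone hs.monotone
      ext i
      exact congrArg _ (hx (congrFun this i))
    · simp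
  · rw [goeQ_of_not_injective v hx, ENNReal.ofReal_zero]
    refine (sum_eq_zero fun σ _ => Set.indicator_of_notMem (fun h => hx ?_) _).symm
    have h : StrictMono (x ∘ σ) := h
    have := h.injective.comp σ.symm.injective
    simpa [Function.comp_assoc] using this

lemma ZL_eq (n : ℕ) (v : ℝ) : ZL n v = (n.factorial : ENNReal) * ZO n v := by
  have hm : Measurable ({x : Fin n → ℝ | StrictMono x}.indicator
      (fun x => ENNReal.ofReal (goeQ n v x))) :=
    (measurable_goeQ n v).ennreal_ofReal.indicator measurableSet_SM
  rw [ZL]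
  rw [lintegral_congr (goeQ_sum v)]
  rw [lintegral_finsetSum]
  · have : ∀ σ : Equiv.Perm (Fin n), ∫⁻ x : Fin n → ℝ, {x : Fin n → ℝ | StrictMono x}.indicator
        (fun x => ENNReal.ofReal (goeQ n v x)) (x ∘ σ) = ZO n v := by
      intro σ
      have h := volume_measurePreserving_piCongrLeft (fun _ : Fin n => ℝ) σ.symm
      rw [ZO, ← lintegral_indicator measurableSet_SM, ← h.lintegral_comp hm]
      refine lintegral_congr fun x => ?_
      congr 1
      ext i
      have := Equiv.piCongrLeft_apply_apply (fun _ : Fin n => ℝ) σ.symm x (σ i)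
      simp only [Equiv.symm_apply_apply] at this
      exact this.symm
    simp_rw [this]
    simp [Fintype.card_perm]
  · intro σ _
    refine hm.comp ?_
    exact measurable_pi_lambda _ fun i => measurable_pi_apply (σ i)

lemma ZO_rec (m : ℕ) {v : ℝ} (hv : 0 < v) :
    ENNReal.ofReal (√π ^ (m + 1)) * ZO (m + 1) v =
      ENNReal.ofReal (Gamma (((m : ℝ) + 1) / 2)) *
        (ENNReal.ofReal (√(4 * π * v) * √(2 * π * v) ^ m) * ZO m v) := by
  set T : (Fin (m + 1) → ℝ) → (Fin m → ℝ) → ENNReal := fun a b =>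
    {p : (Fin (m + 1) → ℝ) × (Fin m → ℝ) | IL p.1 p.2}.indicator (fun p =>
      ENNReal.ofReal (Vd p.1 * exp (-(∑ j, p.1 j ^ 2) / (4 * v)) *
        (Vd p.2 * Cr p.1 p.2 ^ (-(1 : ℝ) / 2)))) (a, b) with hT
  have hILm : MeasurableSet {p : (Fin (m + 1) → ℝ) × (Fin m → ℝ) | IL p.1 p.2} :=
    measurableSet_IL measurable_fst measurable_snd
  have hTm : Measurable (Function.uncurry T) := by
    have : Measurable fun p : (Fin (m + 1) → ℝ) × (Fin m → ℝ) =>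
      ENNReal.ofReal (Vd p.1 * exp (-(∑ j, p.1 j ^ 2) / (4 * v)) *
        (Vd p.2 * Cr p.1 p.2 ^ (-(1 : ℝ) / 2))) := by
      refine Measurable.ennreal_ofReal ?_
      refine Measurable.mul ((measurable_Vd.comp measurable_fst).mul (by fun_prop)) ?_
      exact (measurable_Vd.comp measurable_snd).mul
        ((measurable_Cr measurable_fst measurable_snd).pow_const _)
    exact this.indicator hILm
  have hCr : ∀ (a : Fin (m + 1) → ℝ) (b : Fin m → ℝ), 0 ≤ Cr a b ^ (-(1 : ℝ) / 2) := fun a b =>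
    rpow_nonneg (prod_nonneg fun _ _ => prod_nonneg fun _ _ => abs_nonneg _) _
  have h1 : ENNReal.ofReal (√π ^ (m + 1)) * ZO (m + 1) v =
      ENNReal.ofReal (Gamma (((m : ℝ) + 1) / 2)) * ∫⁻ a, ∫⁻ b, T a b := by
    rw [ZO, ← lintegral_const_mul' _ _ ENNReal.ofReal_ne_top,
      ← lintegral_const_mul' _ _ ENNReal.ofReal_ne_top, ← lintegral_indicator measurableSet_SM]
    refine lintegral_congr fun a => ?_
    by_cases ha : StrictMono a
    · rw [Set.indicator_of_mem (show a ∈ {x : Fin (m + 1) → ℝ | StrictMono x} from ha), keyA ha,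
        mul_assoc]
      congr 1
      rw [mul_comm, ← lintegral_const_mul' _ _ ENNReal.ofReal_ne_top, ← lintegral_indicator
        (measurableSet_IL measurable_const measurable_id : MeasurableSet {b : Fin m → ℝ | IL a b})]
      refine lintegral_congr fun b => ?_
      by_cases h : IL a b
      · rw [hT, Set.indicator_of_mem (show b ∈ {b : Fin m → ℝ | IL a b} from h)]
        simp only
        rw [Set.indicator_of_mem (show (a, b) ∈ {p : (Fin (m + 1) → ℝ) × (Fin m → ℝ) |
          IL p.1 p.2} from h), goeQ_eq, ← ENNReal.ofReal_mul]
        exact mul_nonneg (Vd_nonneg _) (exp_pos _).le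
      · rw [hT, Set.indicator_of_notMem (show b ∉ {b : Fin m → ℝ | IL a b} from h)]
        simp only
        rw [Set.indicator_of_notMem (show (a, b) ∉ {p : (Fin (m + 1) → ℝ) × (Fin m → ℝ) |
          IL p.1 p.2} from h)]
    · rw [Set.indicator_of_notMem (show a ∉ {x : Fin (m + 1) → ℝ | StrictMono x} from ha)]
      have : ∀ b, T a b = 0 := fun b =>
        Set.indicator_of_notMem (fun h : IL a b => ha h.strictMono_a) _
      simp [this]
  have h2 : ∫⁻ b, ∫⁻ a, T a b =
      ENNReal.ofReal (√(4 * π * v) * √(2 * π * v) ^ m) * ZO m v := by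
    rw [ZO, ← lintegral_const_mul' _ _ ENNReal.ofReal_ne_top,
      ← lintegral_indicator measurableSet_SM]
    refine lintegral_congr fun b => ?_
    by_cases hb : StrictMono b
    · rw [Set.indicator_of_mem (show b ∈ {x : Fin m → ℝ | StrictMono x} from hb), goeQ_eq,
        ← ENNReal.ofReal_mul (by positivity), mul_left_comm, ENNReal.ofReal_mul (Vd_nonneg _),
        keyB hb hv, ← lintegral_const_mul' _ _ ENNReal.ofReal_ne_top, ← lintegral_indicator
        (measurableSet_IL measurable_id measurable_const :
          MeasurableSet {a : Fin (m + 1) → ℝ | IL a b})]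
      refine lintegral_congr fun a => ?_
      by_cases h : IL a b
      · rw [hT, Set.indicator_of_mem (show a ∈ {a : Fin (m + 1) → ℝ | IL a b} from h)]
        simp only
        rw [Set.indicator_of_mem (show (a, b) ∈ {p : (Fin (m + 1) → ℝ) × (Fin m → ℝ) |
          IL p.1 p.2} from h), ← ENNReal.ofReal_mul (Vd_nonneg _)]
        congr 1
        ring
      · rw [hT, Set.indicator_of_notMem (show a ∉ {a : Fin (m + 1) → ℝ | IL a b} from h)]
        simp only
        rw [Set.indicator_of_notMem (show (a, b) ∉ {p : (Fin (m + 1) → ℝ) × (Fin m → ℝ) |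
          IL p.1 p.2} from h)]
    · rw [Set.indicator_of_notMem (show b ∉ {x : Fin m → ℝ | StrictMono x} from hb)]
      have : ∀ a, T a b = 0 := fun a =>
        Set.indicator_of_notMem (fun h : IL a b => hb h.strictMono_b) _
      simp [this]
  rw [h1, lintegral_lintegral_swap hTm.aemeasurable, h2]

lemma const_eq (m : ℕ) {v : ℝ} (hv : 0 < v) :
    ((m : ℝ) + 1) * (Gamma (((m : ℝ) + 1) / 2) * (√(4 * π * v) * √(2 * π * v) ^ m)) =
      √π ^ (m + 1) * ((2 : ℝ) ^ ((3 : ℝ) / 2) * (2 * v) ^ (((m : ℝ) + 1) / 2) *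
          Real.Gamma (((m : ℝ) + 3) / 2)) := by
  have hG : Gamma (((m : ℝ) + 3) / 2) = ((m : ℝ) + 1) / 2 * Gamma (((m : ℝ) + 1) / 2) := by
    rw [← Gamma_add_one (by positivity)]
    congr 1
    ring
  have h1 : √(4 * π * v) = √2 * (√π * √(2 * v)) := by
    rw [← sqrt_mul pi_pos.le, ← sqrt_mul (by norm_num)]
    congr 1
    ring
  have h2 : √(2 * π * v) = √π * √(2 * v) := by
    rw [← sqrt_mul pi_pos.le]
    congr 1
    ring
  have h3 : (2 * v) ^ (((m : ℝ) + 1) / 2) = √(2 * v) ^ (m + 1) := by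
    rw [sqrt_eq_rpow, ← rpow_natCast, ← rpow_mul (by positivity)]
    congr 1
    push_cast
    ring
  have h4 : (2 : ℝ) ^ ((3 : ℝ) / 2) = 2 * √2 := by
    rw [sqrt_eq_rpow, show (3 : ℝ) / 2 = 1 + 1 / 2 by norm_num, rpow_add (by norm_num), rpow_one]
  rw [hG, h1, h2, h3, h4, mul_pow]
  ring

lemma ZL_rec (m : ℕ) {v : ℝ} (hv : 0 < v) :
    ZL (m + 1) v = ENNReal.ofReal ((2 : ℝ) ^ ((3 : ℝ) / 2) * (2 * v) ^ (((m : ℝ) + 1) / 2) *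
          Real.Gamma (((m : ℝ) + 3) / 2)) * ZL m v := by
  have hp : ENNReal.ofReal (√π ^ (m + 1)) ≠ 0 := by
    rw [Ne, ENNReal.ofReal_eq_zero, not_le]
    have := sqrt_pos.2 pi_pos
    positivity
  refine (ENNReal.mul_right_inj hp ENNReal.ofReal_ne_top).1 ?_
  have hg : 0 ≤ Gamma (((m : ℝ) + 1) / 2) := (Gamma_pos_of_pos (by positivity)).le
  have e : ((m + 1 : ℕ) : ENNReal) = ENNReal.ofReal ((m : ℝ) + 1) := by
    rw [← ENNReal.ofReal_natCast]
    push_cast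
    rfl
  rw [← mul_assoc, ← ENNReal.ofReal_mul (by positivity), ← const_eq m hv,
    ENNReal.ofReal_mul (by positivity), ENNReal.ofReal_mul hg, ZL_eq, ZL_eq, Nat.factorial_succ,
    Nat.cast_mul, e]
  calc _ = ENNReal.ofReal ((m : ℝ) + 1) * m.factorial *
        (ENNReal.ofReal (√π ^ (m + 1)) * ZO (m + 1) v) := by ring
    _ = _ := by rw [ZO_rec m hv]; ring

lemma K_pos (m : ℕ) {v : ℝ} (hv : 0 < v) : 0 < (2 : ℝ) ^ ((3 : ℝ) / 2) *
    (2 * v) ^ (((m : ℝ) + 1) / 2) * Real.Gamma (((m : ℝ) + 3) / 2) := by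
  have := Gamma_pos_of_pos (show 0 < ((m : ℝ) + 3) / 2 by positivity)
  positivity

lemma ZL_ne (n : ℕ) {v : ℝ} (hv : 0 < v) : ZL n v ≠ 0 ∧ ZL n v ≠ ⊤ := by
  induction n with
  | zero => simp [ZL, goeQ, volume_pi]
  | succ n ih =>
    rw [ZL_rec n hv]
    exact ⟨mul_ne_zero (by simpa using K_pos n hv) ih.1,
      ENNReal.mul_ne_top ENNReal.ofReal_ne_top ih.2⟩

lemma goeZ_eq (n : ℕ) (v : ℝ) : goeZ n v = (ZL n v).toReal :=
  integral_eq_lintegral_of_nonneg_ae (.of_forall fun x => goeQ_nonneg n v x)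
    (measurable_goeQ n v).aestronglyMeasurable

lemma goeZ_pos (n : ℕ) {v : ℝ} (hv : 0 < v) : 0 < goeZ n v := by
  rw [goeZ_eq]
  exact ENNReal.toReal_pos (ZL_ne n hv).1 (ZL_ne n hv).2

lemma goeZ_rec (m : ℕ) {v : ℝ} (hv : 0 < v) :
    goeZ (m + 1) v = ((2 : ℝ) ^ ((3 : ℝ) / 2) * (2 * v) ^ (((m : ℝ) + 1) / 2) *
          Real.Gamma (((m : ℝ) + 3) / 2)) * goeZ m v := by
  rw [goeZ_eq, goeZ_eq, ZL_rec m hv, ENNReal.toReal_mul, ENNReal.toReal_ofReal (K_pos m hv).le]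

lemma goeQ_cons (m : ℕ) (v c : ℝ) (x : Fin m → ℝ) :
    goeQ (m + 1) v (Fin.cons c x) =
      exp (-(c ^ 2 / (4 * v))) * ((∏ i, |c - x i|) * goeQ m v x) := by
  rw [goeQ_eq, goeQ_eq, Vd_cons, Fin.sum_univ_succ]
  simp only [Fin.cons_zero, Fin.cons_succ]
  rw [neg_add, add_div, exp_add, neg_div]
  ring

end GoeAux

/-- for `v > 0` and `c ∈ ℝ`, the expected absolute characteristic polynomial of
`GOE_m^v`, computed via the Weyl integration formula as
`E_{GOE_m^v}(|det(A − c·1_m)|) = (1/Z_m(v)) ∫_{ℝ^m} ∏_i |c − λ_i| · Q_{m,v}(λ) dλ`,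
equals `2^{3/2} (2v)^{(m+1)/2} Γ((m+3)/2) e^{c²/(4v)} ρ_{m+1,v}(c)`. -/
theorem stmt10 (m : ℕ) (hm : 0 < m) (v : ℝ) (hv : 0 < v) (c : ℝ) :
    (1 / goeZ m v) *
        ∫ lam : Fin m → ℝ, (∏ i : Fin m, |c - lam i|) * goeQ m v lam
      = (2 : ℝ) ^ ((3 : ℝ) / 2) * (2 * v) ^ (((m : ℝ) + 1) / 2) *
          Real.Gamma (((m : ℝ) + 3) / 2) * Real.exp (c ^ 2 / (4 * v)) * goeRho m v c := by
  have h1 := GoeAux.goeZ_pos m hv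
  have h2 := GoeAux.K_pos m hv
  rw [goeRho]
  simp_rw [GoeAux.goeQ_cons]
  rw [integral_const_mul, GoeAux.goeZ_rec m hv, Real.exp_neg]
  generalize (∫ lam : Fin m → ℝ, (∏ i : Fin m, |c - lam i|) * goeQ m v lam) = I
  generalize (2 : ℝ) ^ ((3 : ℝ) / 2) * (2 * v) ^ (((m : ℝ) + 1) / 2) *
          Real.Gamma (((m : ℝ) + 3) / 2) = K at h2 ⊢
  have h3 := Real.exp_pos (c ^ 2 / (4 * v))
  field_simp
end
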